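/- Let 1 ≤ p < ∞ and 1 ≤ q < ∞, let g be admissible with g > 0 on ℝ^n∖{0}, and let v : ℝ^n → [0,∞) be radial and nonincreasing in |x|. Then for every Lipschitz continuous u : ℝ^n → ℝ with compact support such that ∫_{ℝ^n} |u|^q v g dx > 0, one has (∫_{ℝ^n} |∇u(x)|^p g(x)^{1−p} dx) / (∫_{ℝ^n} |u(x)|^q v(x) g(x) dx)^{p/q} ≥ (∫_{ℝ^n} |∇(R_g[u])(x)|^p g(x)^{1−p} dx) / (∫_{ℝ^n} R_g[u](x)^q v(x) g(x) dx)^{p/q}, where the gradients exist almost everywhere. -/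

import Mathlib

open Real MeasureTheory Filter Topology Set

/-- The measure determined by `g`: `μ_g(A) = ∫_A g(x) dx`. -/
noncomputable def muG (n : ℕ) (g : EuclideanSpace ℝ (Fin n) → ℝ)
    (A : Set (EuclideanSpace ℝ (Fin n))) : ENNReal :=
  ∫⁻ x in A, ENNReal.ofReal (g x)

/-- The distribution function of `u` with respect to `g`:
`μ_g[u](t) = μ_g({x : |u(x)| > t})`. -/
noncomputable def distG (n : ℕ) (g u : EuclideanSpace ℝ (Fin n) → ℝ) (t : ℝ) : ENNReal :=
  muG n g {x | t < |u x|}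

/-- The rearrangement of `u` with respect to `g`:
`R_g[u](x) = sup {t ≥ 0 : μ_g[u](t) > μ_g(B_{|x|})}`. -/
noncomputable def rearrG (n : ℕ) (g u : EuclideanSpace ℝ (Fin n) → ℝ)
    (x : EuclideanSpace ℝ (Fin n)) : ℝ :=
  sSup {t : ℝ | 0 ≤ t ∧ muG n g (Metric.ball 0 ‖x‖) < distG n g u t}

/-- `g` is admissible: locally integrable, radial, continuous away from the origin,
nonnegative, and nonincreasing in `|x|`. -/
def Admissible (n : ℕ) (g : EuclideanSpace ℝ (Fin n) → ℝ) : Prop :=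
  MeasureTheory.LocallyIntegrable g MeasureTheory.volume ∧
  (∀ x y : EuclideanSpace ℝ (Fin n), ‖x‖ = ‖y‖ → g x = g y) ∧
  ContinuousOn g {x : EuclideanSpace ℝ (Fin n) | x ≠ 0} ∧
  (∀ x : EuclideanSpace ℝ (Fin n), x ≠ 0 → 0 ≤ g x) ∧
  (∀ x y : EuclideanSpace ℝ (Fin n), x ≠ 0 → y ≠ 0 → ‖x‖ ≤ ‖y‖ → g y ≤ g x)




theorem bm_one (A B C : Set ℝ) (hA : MeasurableSet A) (hB : MeasurableSet B)
    (hAn : A.Nonempty) (hBn : B.Nonempty) (h : ∀ a ∈ A, ∀ b ∈ B, a + b ∈ C) :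
    volume A + volume B ≤ volume C := by
  have key : ∀ K L : Set ℝ, IsCompact K → IsCompact L → K.Nonempty → L.Nonempty → K ⊆ A → L ⊆ B →
      volume K + volume L ≤ volume C := by
    intro K L hK hL hKn hLn hKA hLB
    have hm := hK.sSup_mem hKn
    have hm' := hL.sInf_mem hLn
    set m := sSup K with hmdef
    set m' := sInf L with hm'def
    set S := (fun x => -m' + x) ⁻¹' K with hS
    set T := (fun x => -m + x) ⁻¹' L with hT
    have hSm : MeasurableSet S := hK.measurableSet.preimage (by fun_prop)
    have hTm : MeasurableSet T := hL.measurableSet.preimage (by fun_prop)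
    have hSv : volume S = volume K := measure_preimage_add volume _ _
    have hTv : volume T = volume L := measure_preimage_add volume _ _
    have hIntg : volume (S ∩ T) = 0 := by
      apply measure_mono_null (t := {m + m'})
      · rintro x ⟨hx1, hx2⟩
        have h1 : -m' + x ≤ m := le_csSup hK.bddAbove hx1
        have h2 : m' ≤ -m + x := csInf_le hL.bddBelow hx2
        simp only [mem_singleton_iff]; linarith
      · simp
    have := measure_union_add_inter (μ := volume) S hTm
    rw [hIntg, add_zero, hSv, hTv] at this
    rw [← this]
    apply measure_mono
    rintro x (hx | hx)
    · have := h _ (hKA hx) _ (hLB hm'); simpa using this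
    · have := h _ (hKA hm) _ (hLB hx); simpa using this
  obtain ⟨a0, ha0⟩ := hAn
  obtain ⟨b0, hb0⟩ := hBn
  rw [hA.measure_eq_iSup_isCompact, hB.measure_eq_iSup_isCompact]
  have hi1 : ∀ S : Set ℝ, ⨆ K, ⨆ (_ : K ⊆ S), ⨆ (_ : IsCompact K), volume K
      = ⨆ K : {K : Set ℝ // K ⊆ S ∧ IsCompact K}, volume K.1 := by
    intro S
    simp only [iSup_subtype, iSup_and]
  rw [hi1, hi1]
  haveI : ∀ S : Set ℝ, Nonempty {K : Set ℝ // K ⊆ S ∧ IsCompact K} :=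
    fun S => ⟨⟨∅, empty_subset _, isCompact_empty⟩⟩
  refine ENNReal.iSup_add_iSup_le ?_
  rintro ⟨K, hK1, hK2⟩ ⟨L, hL1, hL2⟩
  dsimp only
  calc volume K + volume L ≤ volume (insert a0 K) + volume (insert b0 L) := by
        gcongr <;> exact subset_insert _ _
    _ ≤ _ := key _ _ (hK2.insert _) (hL2.insert _) (by simp) (by simp)
        (insert_subset ha0 hK1) (insert_subset hb0 hL1)

theorem pl_unit (f g h : ℝ → ℝ) (hf : Measurable f) (hg : Measurable g) (hh : Measurable h)
    (f0 : ∀ x, 0 ≤ f x) (g0 : ∀ x, 0 ≤ g x) (h0 : ∀ x, 0 ≤ h x)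
    (f1 : ∀ x, f x ≤ 1) (g1 : ∀ x, g x ≤ 1)
    (fs : ∀ t < 1, ∃ x, t < f x) (gs : ∀ t < 1, ∃ x, t < g x)
    (s r : ℝ) (hs : 0 < s) (hr : 0 < r)
    (H : ∀ x y t, 0 < t → t < 1 → t < f x → t < g y → t < h (s * x + r * y)) :
    ENNReal.ofReal s * (∫⁻ x, ENNReal.ofReal (f x)) + ENNReal.ofReal r * (∫⁻ x, ENNReal.ofReal (g x))
      ≤ ∫⁻ x, ENNReal.ofReal (h x) := by
  rw [lintegral_eq_lintegral_meas_lt _ (ae_of_all _ f0) hf.aemeasurable,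
    lintegral_eq_lintegral_meas_lt _ (ae_of_all _ g0) hg.aemeasurable,
    lintegral_eq_lintegral_meas_lt _ (ae_of_all _ h0) hh.aemeasurable]
  have anti : ∀ k : ℝ → ℝ, Measurable (fun t => volume {a | t < k a}) := by
    intro k
    apply Antitone.measurable
    intro a b hab
    exact measure_mono fun x hx => lt_of_le_of_lt hab hx
  rw [← lintegral_const_mul _ (anti f), ← lintegral_const_mul _ (anti g),
    ← lintegral_add_left ((anti f).const_mul _)]
  apply setLIntegral_mono (anti h)
  intro t ht
  by_cases ht1 : t < 1
  · obtain ⟨x0, hx0⟩ := fs t ht1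
    obtain ⟨y0, hy0⟩ := gs t ht1
    have sc : ∀ (c : ℝ) (S : Set ℝ), 0 < c → 
        volume ((fun x => c⁻¹ • x) ⁻¹' S) = ENNReal.ofReal c * volume S := by
      intro c S hc
      rw [Measure.addHaar_preimage_smul _ (by positivity)]
      simp [abs_of_pos hc]
    rw [← sc s _ hs, ← sc r _ hr]
    apply bm_one
    · exact (measurableSet_lt measurable_const hf).preimage (by fun_prop)
    · exact (measurableSet_lt measurable_const hg).preimage (by fun_prop)
    · exact ⟨s * x0, by simpa [hs.ne'] using hx0⟩
    · exact ⟨r * y0, by simpa [hr.ne'] using hy0⟩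
    · intro a ha b hb
      have := H _ _ t ht ht1 ha hb
      simpa [hs.ne', hr.ne'] using this
  · have e1 : {a | t < f a} = ∅ := by
      ext x; simp; linarith [f1 x]
    have e2 : {a | t < g a} = ∅ := by
      ext x; simp; linarith [g1 x]
    simp [e1, e2]

theorem ennreal_geom (a b : ENNReal) (s r : ℝ) (hs : 0 < s) (hr : 0 < r) (hsr : s + r = 1) :
    a ^ s * b ^ r ≤ ENNReal.ofReal s * a + ENNReal.ofReal r * b := by
  have hc : (s⁻¹).HolderConjugate (r⁻¹) := by
    rw [Real.holderConjugate_iff]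
    refine ⟨?_, by simpa⟩
    apply (one_lt_inv₀ hs).2; linarith
  have := ENNReal.young_inequality (a ^ s) (b ^ r) hc
  rw [← ENNReal.rpow_mul, ← ENNReal.rpow_mul, mul_inv_cancel₀ hs.ne', mul_inv_cancel₀ hr.ne',
    ENNReal.rpow_one, ENNReal.rpow_one, ENNReal.ofReal_inv_of_pos hs, ENNReal.ofReal_inv_of_pos hr,
    div_eq_mul_inv, div_eq_mul_inv, inv_inv, inv_inv] at this
  rwa [mul_comm a, mul_comm b] at this

theorem pl_bdd (f g h : ℝ → ENNReal) (hf : Measurable f) (hg : Measurable g) (hh : Measurable h)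
    (k : ENNReal) (hk : k ≠ ⊤) (fk : ∀ x, f x ≤ k) (gk : ∀ x, g x ≤ k)
    (s r : ℝ) (hs : 0 < s) (hr : 0 < r) (hsr : s + r = 1)
    (H : ∀ x y, f x ^ s * g y ^ r ≤ h (s * x + r * y)) :
    (∫⁻ x, f x) ^ s * (∫⁻ x, g x) ^ r ≤ ∫⁻ x, h x := by
  set M := ⨆ x, f x with hM
  set N := ⨆ x, g x with hN
  have hMt : M ≠ ⊤ := ne_top_of_le_ne_top hk (iSup_le fk)
  have hNt : N ≠ ⊤ := ne_top_of_le_ne_top hk (iSup_le gk)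
  by_cases hM0 : M = 0
  · have : ∀ x, f x = 0 := fun x => le_antisymm (hM0 ▸ le_iSup f x) bot_le
    simp [this, hs]
  by_cases hN0 : N = 0
  · have : ∀ x, g x = 0 := fun x => le_antisymm (hN0 ▸ le_iSup g x) bot_le
    simp [this, hr]
  set Q := M ^ s * N ^ r with hQ
  have hQ0 : Q ≠ 0 := by
    apply mul_ne_zero <;> simp [ENNReal.rpow_eq_zero_iff, hM0, hN0, hMt, hNt]
  have hQt : Q ≠ ⊤ := ENNReal.mul_ne_top (ENNReal.rpow_ne_top_of_nonneg hs.le hMt)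
    (ENNReal.rpow_ne_top_of_nonneg hr.le hNt)
  have gen : ∀ (F : ℝ → ENNReal) (P : ENNReal), P = (⨆ x, F x) → P ≠ 0 → P ≠ ⊤ →
      (∀ x, F x / P ≤ 1) ∧ (∀ t < (1:ℝ), ∃ x, t < (F x / P).toReal) := by
    intro F P hP h0 ht
    have h1 : ∀ x, F x / P ≤ 1 := fun x => ENNReal.div_le_of_le_mul (by simpa [hP] using le_iSup F x)
    refine ⟨h1, ?_⟩
    intro t ht1
    have : ENNReal.ofReal t * P < P := by
      conv_rhs => rw [← one_mul P]
      exact ENNReal.mul_lt_mul_left h0 ht (by simpa using ht1)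
    conv at this => rhs; rw [hP]
    obtain ⟨x, hx⟩ := lt_iSup_iff.1 this
    refine ⟨x, ?_⟩
    have h2 : ENNReal.ofReal t < F x / P := by
      rw [ENNReal.lt_div_iff_mul_lt (Or.inl h0) (Or.inl ht)]; exact hx
    rcases lt_or_ge t 0 with h3 | h3
    · exact h3.trans_le ENNReal.toReal_nonneg
    · exact (ENNReal.ofReal_lt_iff_lt_toReal h3 (ne_top_of_le_ne_top ENNReal.one_ne_top (h1 x))).1 h2
  obtain ⟨f1, fs⟩ := gen f M hM hM0 hMt
  obtain ⟨g1, gs⟩ := gen g N hN hN0 hNt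
  have key := pl_unit (fun x => (f x / M).toReal) (fun x => (g x / N).toReal)
    (fun x => (min (h x / Q) 1).toReal) (by fun_prop) (by fun_prop) (by fun_prop)
    (fun _ => ENNReal.toReal_nonneg) (fun _ => ENNReal.toReal_nonneg)
    (fun _ => ENNReal.toReal_nonneg)
    (fun x => ENNReal.toReal_le_of_le_ofReal zero_le_one (by simpa using f1 x))
    (fun x => ENNReal.toReal_le_of_le_ofReal zero_le_one (by simpa using g1 x)) fs gs s r hs hr
    (by
      intro x y t ht0 ht1 hx hy
      have hx' : ENNReal.ofReal t < f x / M := (ENNReal.ofReal_lt_iff_lt_toReal ht0.le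
        (ne_top_of_le_ne_top ENNReal.one_ne_top (f1 x))).2 hx
      have hy' : ENNReal.ofReal t < g y / N := (ENNReal.ofReal_lt_iff_lt_toReal ht0.le
        (ne_top_of_le_ne_top ENNReal.one_ne_top (g1 y))).2 hy
      refine (ENNReal.ofReal_lt_iff_lt_toReal ht0.le
        (ne_top_of_le_ne_top ENNReal.one_ne_top (min_le_right _ _))).1 (lt_min ?_ (by simpa using ht1))
      have e : ENNReal.ofReal t = ENNReal.ofReal t ^ s * ENNReal.ofReal t ^ r := by
        rw [← ENNReal.rpow_add _ _ (by simpa using ht0) (by simp), hsr, ENNReal.rpow_one]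
      rw [e]
      calc _ < (f x / M) ^ s * (g y / N) ^ r := by
            apply ENNReal.mul_lt_mul
            · exact ENNReal.rpow_lt_rpow hx' hs
            · exact ENNReal.rpow_lt_rpow hy' hr
        _ = f x ^ s * g y ^ r / Q := by
            rw [ENNReal.div_rpow_of_nonneg _ _ hs.le, ENNReal.div_rpow_of_nonneg _ _ hr.le, hQ,
              div_eq_mul_inv, div_eq_mul_inv, div_eq_mul_inv, ENNReal.mul_inv]
            · ring
            · right; exact ENNReal.rpow_ne_top_of_nonneg hr.le hNt
            · left; exact ENNReal.rpow_ne_top_of_nonneg hs.le hMt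
        _ ≤ _ := by gcongr; exact H x y)
  have e1 : ∀ x, ENNReal.ofReal (f x / M).toReal = f x / M := fun x => 
    ENNReal.ofReal_toReal (ne_top_of_le_ne_top ENNReal.one_ne_top (f1 x))
  have e2 : ∀ x, ENNReal.ofReal (g x / N).toReal = g x / N := fun x => 
    ENNReal.ofReal_toReal (ne_top_of_le_ne_top ENNReal.one_ne_top (g1 x))
  have e3 : ∀ x, ENNReal.ofReal (min (h x / Q) 1).toReal ≤ h x / Q := fun x => 
    ENNReal.ofReal_toReal_le.trans (min_le_left _ _)
  simp only [e1, e2] at key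
  have key2 := (ennreal_geom (∫⁻ x, f x / M) (∫⁻ x, g x / N) s r hs hr hsr).trans
    (key.trans (lintegral_mono e3))
  simp only [div_eq_mul_inv] at key2
  rw [lintegral_mul_const _ hf, lintegral_mul_const _ hg, lintegral_mul_const _ hh,
    ENNReal.mul_rpow_of_nonneg _ _ hs.le, ENNReal.mul_rpow_of_nonneg _ _ hr.le,
    ENNReal.inv_rpow, ENNReal.inv_rpow] at key2
  have e4 : Q⁻¹ = (M ^ s)⁻¹ * (N ^ r)⁻¹ := by
    rw [hQ, ENNReal.mul_inv]
    · right; exact ENNReal.rpow_ne_top_of_nonneg hr.le hNt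
    · left; exact ENNReal.rpow_ne_top_of_nonneg hs.le hMt
  have e5 : (∫⁻ x, f x) ^ s * (∫⁻ x, g x) ^ r * Q⁻¹ ≤ (∫⁻ x, h x) * Q⁻¹ := by
    refine le_trans (le_of_eq ?_) key2
    rw [e4]; ring
  exact (ENNReal.mul_le_mul_iff_left (ENNReal.inv_ne_zero.2 hQt) (ENNReal.inv_ne_top.2 hQ0)).1 e5

theorem pl_one (f g h : ℝ → ENNReal) (hf : Measurable f) (hg : Measurable g) (hh : Measurable h)
    (s r : ℝ) (hs : 0 < s) (hr : 0 < r) (hsr : s + r = 1)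
    (H : ∀ x y, f x ^ s * g y ^ r ≤ h (s * x + r * y)) :
    (∫⁻ x, f x) ^ s * (∫⁻ x, g x) ^ r ≤ ∫⁻ x, h x := by
  by_cases hF0 : ∫⁻ x, f x = 0
  · simp [hF0, hs]
  by_cases hG0 : ∫⁻ x, g x = 0
  · simp [hG0, hr]
  have conv : ∀ F : ℝ → ENNReal, Measurable F → 
      Tendsto (fun k : ℕ => ∫⁻ x, min (F x) k) atTop (𝓝 (∫⁻ x, F x)) := by
    intro F hF
    apply lintegral_tendsto_of_tendsto_of_monotone
    · intro k; exact (hF.min measurable_const).aemeasurable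
    · exact ae_of_all _ fun x i j hij => min_le_min le_rfl (by exact_mod_cast hij)
    · refine ae_of_all _ fun x => ?_
      have := (tendsto_const_nhds (x := F x) (f := atTop)).min ENNReal.tendsto_nat_nhds_top
      simpa using this
  have t1 := ((ENNReal.continuous_rpow_const (y := s)).tendsto _).comp (conv f hf)
  have t2 := ((ENNReal.continuous_rpow_const (y := r)).tendsto _).comp (conv g hg)
  have t3 := ENNReal.Tendsto.mul t1 (by left; simp [ENNReal.rpow_eq_zero_iff, hF0, hs.le]) t2 
    (by left; simp [ENNReal.rpow_eq_zero_iff, hG0, hr.le])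
  refine le_of_tendsto' t3 fun k => ?_
  refine pl_bdd _ _ h (hf.min measurable_const) (hg.min measurable_const) hh k (by simp)
    (fun x => min_le_right _ _) (fun x => min_le_right _ _) s r hs hr hsr ?_
  intro x y
  refine le_trans ?_ (H x y)
  gcongr <;> exact min_le_left _ _

theorem pl_fin (n : ℕ) : ∀ (f g h : (Fin n → ℝ) → ENNReal), Measurable f → Measurable g →
    Measurable h → ∀ (s r : ℝ), 0 < s → 0 < r → s + r = 1 →
    (∀ x y, f x ^ s * g y ^ r ≤ h (s • x + r • y)) →
    (∫⁻ x, f x) ^ s * (∫⁻ x, g x) ^ r ≤ ∫⁻ x, h x := by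
  induction n with
  | zero =>
    intro f g h hf hg hh s r hs hr hsr H
    have hv : (volume : Measure (Fin 0 → ℝ)) univ = 1 := by
      simp [volume_pi]
    rw [lintegral_unique, lintegral_unique, lintegral_unique, hv, mul_one, mul_one, mul_one]
    convert H default default
  | succ n ih =>
    intro f g h hf hg hh s r hs hr hsr H
    have mp := (volume_preserving_piFinSuccAbove (fun _ : Fin (n+1) => ℝ) 0).symm
    have he : ∀ (a : ℝ) (y : Fin n → ℝ), (MeasurableEquiv.piFinSuccAbove (fun _ : Fin (n+1) => ℝ) 0).symm (a, y)
        = Fin.cons a y := by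
      intro a y
      ext i
      refine Fin.cases ?_ (fun j => ?_) i <;> simp [MeasurableEquiv.piFinSuccAbove]
    have split : ∀ F : (Fin (n+1) → ℝ) → ENNReal, Measurable F →
        ∫⁻ x, F x = ∫⁻ a : ℝ, ∫⁻ y : Fin n → ℝ, F (Fin.cons a y) := by
      intro F hF
      rw [← mp.lintegral_comp hF]
      rw [Measure.volume_eq_prod, lintegral_prod _ (by
        exact (hF.comp (MeasurableEquiv.measurable _)).aemeasurable)]
      simp only [he]
    have mc : Measurable (fun z : ℝ × (Fin n → ℝ) => (Fin.cons z.1 z.2 : Fin (n+1) → ℝ)) := by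
      simp only [← he]
      exact (MeasurableEquiv.piFinSuccAbove (fun _ : Fin (n+1) => ℝ) 0).symm.measurable
    rw [split f hf, split g hg, split h hh]
    apply pl_one _ _ _ _ _ _ s r hs hr hsr
    · intro a b
      apply ih _ _ _ _ _ _ s r hs hr hsr
      · intro x y
        convert H (Fin.cons a x) (Fin.cons b y) using 2
        ext i
        refine Fin.cases ?_ (fun j => ?_) i <;> simp
      · exact hf.comp (mc.comp (by fun_prop : Measurable fun y => (a, y)))
      · exact hg.comp (mc.comp (by fun_prop : Measurable fun y => (b, y)))
      · exact hh.comp (mc.comp (by fun_prop : Measurable fun y => (s * a + r * b, y)))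
    · exact (hf.comp mc).lintegral_prod_right'
    · exact (hg.comp mc).lintegral_prod_right'
    · exact (hh.comp mc).lintegral_prod_right'

theorem pl_euclid (n : ℕ) (f g h : EuclideanSpace ℝ (Fin n) → ENNReal) (hf : Measurable f)
    (hg : Measurable g) (hh : Measurable h) (s r : ℝ) (hs : 0 < s) (hr : 0 < r) (hsr : s + r = 1)
    (H : ∀ x y, f x ^ s * g y ^ r ≤ h (s • x + r • y)) :
    (∫⁻ x, f x) ^ s * (∫⁻ x, g x) ^ r ≤ ∫⁻ x, h x := by
  have mp := PiLp.volume_preserving_toLp (Fin n)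
  rw [← mp.lintegral_comp hf, ← mp.lintegral_comp hg, ← mp.lintegral_comp hh]
  apply pl_fin n _ _ _ (hf.comp mp.measurable) (hg.comp mp.measurable) (hh.comp mp.measurable)
    s r hs hr hsr
  intro x y
  exact H _ _

/-- Brunn-Minkowski with a ball. -/
theorem bm_ball (n : ℕ) (hn : 0 < n) (A C : Set (EuclideanSpace ℝ (Fin n))) (hA : MeasurableSet A)
    (hC : MeasurableSet C) (a ε : ℝ) (ha : 0 < a) (hε : 0 < ε)
    (hvol : volume (Metric.ball (0 : EuclideanSpace ℝ (Fin n)) a) ≤ volume A)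
    (h : ∀ x ∈ A, ∀ y ∈ Metric.ball (0 : EuclideanSpace ℝ (Fin n)) ε, x + y ∈ C) :
    volume (Metric.ball (0 : EuclideanSpace ℝ (Fin n)) (a + ε)) ≤ volume C := by
  set X := volume (Metric.ball (0 : EuclideanSpace ℝ (Fin n)) (a + ε)) with hX
  haveI : Nonempty (Fin n) := ⟨⟨0, hn⟩⟩
  have hae : 0 < a + ε := by positivity
  set s := a / (a + ε) with hs
  set r := ε / (a + ε) with hr
  have hs0 : 0 < s := by positivity
  have hr0 : 0 < r := by positivity
  have hsr : s + r = 1 := by rw [hs, hr]; field_simp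
  have hA' : MeasurableSet ((fun x : EuclideanSpace ℝ (Fin n) => s • x) ⁻¹' A) :=
    hA.preimage (by fun_prop)
  have key := pl_euclid n (((fun x => s • x) ⁻¹' A).indicator 1)
    ((Metric.ball 0 (a + ε)).indicator 1) (C.indicator 1) 
    (measurable_one.indicator hA') (measurable_one.indicator Metric.isOpen_ball.measurableSet)
    (measurable_one.indicator hC) s r hs0 hr0 hsr (by
      intro x y
      by_cases hx : x ∈ (fun x => s • x) ⁻¹' A
      · by_cases hy : y ∈ Metric.ball (0 : EuclideanSpace ℝ (Fin n)) (a + ε)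
        · have : s • x + r • y ∈ C := by
            apply h _ hx
            simp only [mem_ball_zero_iff] at hy ⊢
            rw [norm_smul, norm_of_nonneg hr0.le, hr]
            calc ε / (a + ε) * ‖y‖ < ε / (a + ε) * (a + ε) := by gcongr
              _ = ε := by field_simp
          simp [this, hx, hy]
        · simp [hy, hr0]
      · simp [hx, hs0])
  rw [lintegral_indicator_one hA', lintegral_indicator_one Metric.isOpen_ball.measurableSet,
    lintegral_indicator_one hC] at key
  have hle : X ≤ volume ((fun x : EuclideanSpace ℝ (Fin n) => s • x) ⁻¹' A) := by
    calc X = volume ((fun x : EuclideanSpace ℝ (Fin n) => s • x) ⁻¹' (Metric.ball 0 a)) := by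
          rw [hX]
          congr 1
          ext x
          simp only [mem_ball_zero_iff, mem_preimage, norm_smul, norm_of_nonneg hs0.le]
          rw [hs, div_mul_eq_mul_div, div_lt_iff₀ hae, mul_lt_mul_iff_right₀ ha]
      _ ≤ _ := by
          rw [Measure.addHaar_preimage_smul _ hs0.ne', Measure.addHaar_preimage_smul _ hs0.ne']
          gcongr
  have hX0 : X ≠ 0 := (Metric.measure_ball_pos _ _ hae).ne'
  have hXt : X ≠ ⊤ := measure_ball_lt_top.ne
  calc X = X ^ s * X ^ r := by rw [← ENNReal.rpow_add _ _ hX0 hXt, hsr, ENNReal.rpow_one]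
    _ ≤ _ := by
      refine le_trans ?_ key
      gcongr


/-- The sup-convolution of `φ` with a ball. -/
noncomputable def supBall (n : ℕ) (φ : EuclideanSpace ℝ (Fin n) → ℝ) (ε : ℝ)
    (x : EuclideanSpace ℝ (Fin n)) : ℝ :=
  ⨆ y : Metric.ball (0 : EuclideanSpace ℝ (Fin n)) ε, φ (x + y)

section
variable {n : ℕ} {φ : EuclideanSpace ℝ (Fin n) → ℝ}

theorem supBall_bdd (φ1 : ∀ x, φ x ≤ 1) (ε : ℝ) (x : EuclideanSpace ℝ (Fin n)) :
    BddAbove (range fun y : Metric.ball (0 : EuclideanSpace ℝ (Fin n)) ε => φ (x + y)) :=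
  ⟨1, by rintro _ ⟨y, rfl⟩; exact φ1 _⟩

theorem le_supBall (φ1 : ∀ x, φ x ≤ 1) (ε : ℝ) (x y : EuclideanSpace ℝ (Fin n)) (hy : ‖y‖ < ε) :
    φ (x + y) ≤ supBall n φ ε x :=
  le_ciSup (supBall_bdd φ1 ε x) ⟨y, by simpa using hy⟩

theorem supBall_le {ε : ℝ} (hε : 0 < ε) (x : EuclideanSpace ℝ (Fin n)) (c : ℝ)
    (h : ∀ y, ‖y‖ < ε → φ (x + y) ≤ c) : supBall n φ ε x ≤ c := by
  have : Nonempty (Metric.ball (0 : EuclideanSpace ℝ (Fin n)) ε) := ⟨⟨0, by simpa using hε⟩⟩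
  exact ciSup_le fun y => h _ (mem_ball_zero_iff.1 y.2)

theorem self_le_supBall (φ1 : ∀ x, φ x ≤ 1) {ε : ℝ} (hε : 0 < ε) (x : EuclideanSpace ℝ (Fin n)) :
    φ x ≤ supBall n φ ε x := by
  simpa using le_supBall φ1 ε x 0 (by simpa using hε)

theorem measurable_supBall (hφ : Continuous φ) (φ1 : ∀ x, φ x ≤ 1) (ε : ℝ) :
    Measurable (supBall n φ ε) := by
  apply LowerSemicontinuous.measurable
  apply lowerSemicontinuous_ciSup (supBall_bdd φ1 ε)
  intro y
  exact (hφ.comp (by fun_prop)).lowerSemicontinuous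

end

theorem pow_bern (a ε : ℝ) (ha : 0 ≤ a) (hε : 0 ≤ ε) (n : ℕ) :
    a ^ n + n * ε * a ^ (n - 1) ≤ (a + ε) ^ n := by
  induction n with
  | zero => simp
  | succ n ih =>
    rw [pow_succ (a + ε)]
    have h1 : (a ^ n + n * ε * a ^ (n - 1)) * (a + ε) ≤ (a + ε) ^ n * (a + ε) := by gcongr
    refine le_trans ?_ h1
    rcases n with _ | m
    · simp
    · have : 0 ≤ (m + 1) * ε * ε * a ^ m := by positivity
      simp only [Nat.add_sub_cancel]
      push_cast
      ring_nf at this ⊢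
      nlinarith

theorem supBall_layer (n : ℕ) (hn : 0 < n) (φ : EuclideanSpace ℝ (Fin n) → ℝ)
    (hφ : Continuous φ) (hs : HasCompactSupport φ) (φ0 : ∀ x, 0 ≤ φ x) (φ1 : ∀ x, φ x ≤ 1)
    (r : ℝ) (hr : 0 < r) 
    (hvol : volume (Metric.ball (0 : EuclideanSpace ℝ (Fin n)) r) ≤ volume {x | 1 ≤ φ x})
    (ε : ℝ) (hε : 0 < ε) :
    (∫⁻ x, ENNReal.ofReal (φ x)) + ENNReal.ofReal (n * ε * r ^ (n - 1)) *
      volume (Metric.ball (0 : EuclideanSpace ℝ (Fin n)) 1) ≤ 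
      ∫⁻ x, ENNReal.ofReal (supBall n φ ε x) := by
  have : Nonempty (Fin n) := ⟨⟨0, hn⟩⟩
  set ω := volume (Metric.ball (0 : EuclideanSpace ℝ (Fin n)) 1) with hω
  have hω0 : ω ≠ 0 := (Metric.measure_ball_pos _ _ one_pos).ne'
  have hωt : ω ≠ ⊤ := measure_ball_lt_top.ne
  have hball : ∀ a : ℝ, 0 ≤ a → volume (Metric.ball (0 : EuclideanSpace ℝ (Fin n)) a) =
      ENNReal.ofReal (a ^ n) * ω := by
    intro a ha
    rw [Measure.addHaar_ball _ _ ha, hω]; simp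
  set C := ENNReal.ofReal (n * ε * r ^ (n - 1)) * ω with hC
  rw [lintegral_eq_lintegral_meas_lt _ (ae_of_all _ φ0) hφ.measurable.aemeasurable,
    lintegral_eq_lintegral_meas_lt _ (ae_of_all _ fun x => (φ0 x).trans (self_le_supBall φ1 hε x))
      (measurable_supBall hφ φ1 ε).aemeasurable]
  have anti : ∀ k : EuclideanSpace ℝ (Fin n) → ℝ, Measurable (fun t => volume {a | t < k a}) := by
    intro k
    apply Antitone.measurable
    intro a b hab
    exact measure_mono fun x hx => lt_of_le_of_lt hab hx
  have hC' : C = ∫⁻ t in Ioi (0:ℝ), (Ioo (0:ℝ) 1).indicator (fun _ => C) t := by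
    rw [lintegral_indicator measurableSet_Ioo, Measure.restrict_restrict measurableSet_Ioo,
      inter_eq_left.2 Ioo_subset_Ioi_self]
    simp
  rw [hC', ← lintegral_add_left (anti φ)]
  apply setLIntegral_mono (anti _)
  intro t ht
  by_cases ht1 : t < 1
  · have htm : t ∈ Ioo (0:ℝ) 1 := ⟨ht, ht1⟩
    rw [indicator_of_mem htm]
    have hA : MeasurableSet {x | t < φ x} := measurableSet_lt measurable_const hφ.measurable
    set v := volume {x | t < φ x} with hv
    have hvt : v ≠ ⊤ := by
      refine ne_top_of_le_ne_top hs.measure_lt_top.ne (measure_mono ?_)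
      intro x hx
      exact subset_tsupport _ (show φ x ≠ 0 from (lt_trans ht hx).ne')
    have hvr : volume (Metric.ball (0 : EuclideanSpace ℝ (Fin n)) r) ≤ v :=
      hvol.trans (measure_mono fun x hx => lt_of_lt_of_le ht1 hx)
    set a : ℝ := (v / ω).toReal ^ ((n:ℝ)⁻¹) with ha
    have ha0 : 0 ≤ a := by positivity
    have han : a ^ n = (v / ω).toReal := Real.rpow_inv_natCast_pow ENNReal.toReal_nonneg hn.ne'
    have hva : volume (Metric.ball (0 : EuclideanSpace ℝ (Fin n)) a) = v := by
      rw [hball a ha0, han, ENNReal.ofReal_toReal (ENNReal.div_ne_top hvt hω0),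
        ENNReal.div_mul_cancel hω0 hωt]
    have har : r ≤ a := by
      rw [hball r hr.le, ← hva, hball a ha0, ENNReal.mul_le_mul_iff_left hω0 hωt, 
        ENNReal.ofReal_le_ofReal_iff (by positivity)] at hvr
      exact (pow_le_pow_iff_left₀ hr.le ha0 hn.ne').1 hvr
    have hE := bm_ball n hn {x | t < φ x} {x | t < supBall n φ ε x} hA 
      (measurableSet_lt measurable_const (measurable_supBall hφ φ1 ε)) a ε (hr.trans_le har) hε
      hva.le (by
        intro x hx y hy
        have := le_supBall φ1 ε (x + y) (-y) (by simpa using hy)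
        rw [add_neg_cancel_right] at this
        exact lt_of_lt_of_le hx this)
    refine le_trans ?_ hE
    rw [hball _ (by positivity), ← hva, hball a ha0, hC, ← add_mul, 
      ← ENNReal.ofReal_add (by positivity) (by positivity)]
    gcongr
    refine le_trans ?_ (pow_bern a ε ha0 hε.le n)
    gcongr
  · have e1 : {a | t < φ a} = ∅ := by
      ext x; simp; linarith [φ1 x]
    have : t ∉ Ioo (0:ℝ) 1 := fun h => ht1 h.2
    simp [e1, this]

theorem iso_fun (n : ℕ) (hn : 0 < n) (φ : EuclideanSpace ℝ (Fin n) → ℝ) (L : NNReal)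
    (hφ : LipschitzWith L φ) (hs : HasCompactSupport φ) (φ0 : ∀ x, 0 ≤ φ x) (φ1 : ∀ x, φ x ≤ 1)
    (r : ℝ) (hr : 0 < r) 
    (hvol : volume (Metric.ball (0 : EuclideanSpace ℝ (Fin n)) r) ≤ volume {x | 1 ≤ φ x}) :
    n * r ^ (n - 1) * volume.real (Metric.ball (0 : EuclideanSpace ℝ (Fin n)) 1) ≤ 
      ∫ x, ‖fderiv ℝ φ x‖ := by
  set S := Metric.cthickening 1 (tsupport φ) with hS
  have hSc : IsCompact S := hs.isCompact.cthickening
  have hfd : ∀ x, ‖fderiv ℝ φ x‖ ≤ S.indicator (fun _ => (L:ℝ)) x := by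
    intro x
    by_cases hx : x ∈ S
    · rw [indicator_of_mem hx]; exact norm_fderiv_le_of_lipschitz ℝ hφ
    · have hx' : x ∉ tsupport φ := fun h => hx (Metric.self_subset_cthickening _ h)
      have : fderiv ℝ φ x = 0 := by
        by_contra h
        exact hx' (support_fderiv_subset ℝ (f := φ) h)
      rw [indicator_of_notMem hx, this, norm_zero]
  have hout : ∀ ε : ℝ, 0 < ε → ε ≤ 1 → ∀ x, x ∉ S → supBall n φ ε x = 0 ∧ φ x = 0 := by
    intro ε hε hε1 x hx
    have hz : ∀ y, ‖y‖ < ε → φ (x + y) = 0 := by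
      intro y hy
      by_contra h
      apply hx
      apply Metric.mem_cthickening_of_dist_le x (x + y) _ _ (subset_tsupport _ h)
      simp; linarith
    have h0 := hz 0 (by simpa using hε)
    rw [add_zero] at h0
    refine ⟨le_antisymm (supBall_le hε x 0 fun y hy => (hz y hy).le) ?_, h0⟩
    rw [← h0]; exact self_le_supBall φ1 hε x
  have hlip : ∀ ε : ℝ, 0 < ε → ∀ x, supBall n φ ε x ≤ φ x + L * ε := by
    intro ε hε x
    apply supBall_le hε
    intro y hy
    have := hφ.dist_le_mul (x + y) x
    rw [Real.dist_eq] at this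
    have h2 := (le_abs_self _).trans this
    simp only [dist_self_add_left] at h2
    nlinarith [L.2, mul_le_mul_of_nonneg_left hy.le L.2]
  set e : ℕ → ℝ := fun k => 1 / ((k:ℝ) + 1) with he
  have he0 : ∀ k, 0 < e k := fun k => by positivity
  have he1 : ∀ k, e k ≤ 1 := fun k => by
    rw [he]; simp only; rw [div_le_one (by positivity)]; linarith [(Nat.cast_nonneg k : (0:ℝ) ≤ k)]
  have het : Tendsto e atTop (𝓝 0) := tendsto_one_div_add_atTop_nhds_zero_nat
  set D : ℕ → EuclideanSpace ℝ (Fin n) → ℝ := 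
    fun k x => max ((supBall n φ (e k) x - φ x) / e k) ‖fderiv ℝ φ x‖ with hD
  have hbi : Integrable (S.indicator (fun _ => (L:ℝ))) (volume : Measure (EuclideanSpace ℝ (Fin n))) := by
    rw [integrable_indicator_iff hSc.measurableSet]
    exact integrableOn_const hSc.measure_lt_top.ne
  have hφi : Integrable φ volume := hφ.continuous.integrable_of_hasCompactSupport hs
  have hψi : ∀ k, Integrable (supBall n φ (e k)) volume := by
    intro k
    refine Integrable.mono' (g := S.indicator (fun _ => (1:ℝ))) ?_ 
      (measurable_supBall hφ.continuous φ1 _).aestronglyMeasurable (ae_of_all _ ?_)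
    · rw [integrable_indicator_iff hSc.measurableSet]
      exact integrableOn_const hSc.measure_lt_top.ne
    · intro x
      by_cases hx : x ∈ S
      · rw [indicator_of_mem hx, norm_of_nonneg ((φ0 x).trans (self_le_supBall φ1 (he0 k) x))]
        exact supBall_le (he0 k) x 1 fun y _ => φ1 _
      · simp [(hout _ (he0 k) (he1 k) x hx).1, hx]
  have hdm : Measurable (fun x => ‖fderiv ℝ φ x‖) := (measurable_fderiv ℝ φ).norm
  have hDb : ∀ k x, ‖D k x‖ ≤ S.indicator (fun _ => (L:ℝ)) x := by
    intro k x
    rw [norm_of_nonneg ((norm_nonneg _).trans (le_max_right _ _))]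
    refine max_le ?_ (hfd x)
    by_cases hx : x ∈ S
    · rw [indicator_of_mem hx, div_le_iff₀ (he0 k)]
      linarith [hlip _ (he0 k) x]
    · rw [(hout _ (he0 k) (he1 k) x hx).1, (hout _ (he0 k) (he1 k) x hx).2]; simp [hx]
  have hDm : ∀ k, AEStronglyMeasurable (D k) volume := fun k =>
    ((((measurable_supBall hφ.continuous φ1 _).sub hφ.continuous.measurable).div_const _).max
      hdm).aestronglyMeasurable
  have hlim : Tendsto (fun k => ∫ x, D k x) atTop (𝓝 (∫ x, ‖fderiv ℝ φ x‖)) := by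
    apply tendsto_integral_of_dominated_convergence _ hDm hbi (fun k => ae_of_all _ (hDb k))
    filter_upwards [hφ.ae_differentiableAt] with x hx
    have hd := hx.hasFDerivAt
    rw [Metric.tendsto_atTop]
    intro δ hδ
    rw [hasFDerivAt_iff_isLittleO_nhds_zero] at hd
    have hd2 := hd.def (half_pos hδ)
    rw [Metric.eventually_nhds_iff] at hd2
    obtain ⟨η, hη, hd3⟩ := hd2
    obtain ⟨N, hN⟩ := (Metric.tendsto_atTop.1 het) η hη
    refine ⟨N, fun k hk => ?_⟩
    have hek : e k < η := by
      have := hN k hk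
      rwa [Real.dist_eq, sub_zero, abs_of_pos (he0 k)] at this
    have hup : (supBall n φ (e k) x - φ x) / e k ≤ ‖fderiv ℝ φ x‖ + δ / 2 := by
      rw [div_le_iff₀ (he0 k), sub_le_iff_le_add]
      apply supBall_le (he0 k)
      intro y hy
      have h1 := hd3 (y := y) (by simpa using hy.trans hek)
      have h2 := (le_abs_self _).trans h1
      have h3 := (le_abs_self _).trans ((fderiv ℝ φ x).le_opNorm y)
      have h4 : (‖fderiv ℝ φ x‖ + δ / 2) * ‖y‖ ≤ (‖fderiv ℝ φ x‖ + δ / 2) * e k := by gcongr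
      linarith
    have h5 : D k x ≤ ‖fderiv ℝ φ x‖ + δ / 2 := max_le hup (by linarith)
    have h6 : ‖fderiv ℝ φ x‖ ≤ D k x := le_max_right _ _
    rw [Real.dist_eq, abs_of_nonneg (by linarith)]; linarith
  refine ge_of_tendsto' hlim fun k => ?_
  have hlay := supBall_layer n hn φ hφ.continuous hs φ0 φ1 r hr hvol (e k) (he0 k)
  rw [← ofReal_integral_eq_lintegral_ofReal hφi (ae_of_all _ φ0),
    ← ofReal_integral_eq_lintegral_ofReal (hψi k) 
      (ae_of_all _ fun x => (φ0 x).trans (self_le_supBall φ1 (he0 k) x)),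
    ← ENNReal.ofReal_toReal (measure_ball_lt_top (x := (0 : EuclideanSpace ℝ (Fin n))) (r := 1) (μ := volume)).ne,
    ← ENNReal.ofReal_mul (by have := (he0 k).le; positivity), 
    ← ENNReal.ofReal_add (integral_nonneg φ0) (by have := (he0 k).le; positivity), 
    ENNReal.ofReal_le_ofReal_iff (integral_nonneg fun x => (φ0 x).trans (self_le_supBall φ1 (he0 k) x))] at hlay
  have hDi : Integrable (D k) volume := hbi.mono' (hDm k) (ae_of_all _ (hDb k))
  have h7 : ∫ x, (supBall n φ (e k) x - φ x) / e k ≤ ∫ x, D k x :=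
    integral_mono (((hψi k).sub hφi).div_const _) hDi fun x => le_max_left _ _
  refine le_trans ?_ h7
  rw [integral_div, integral_sub (hψi k) hφi, le_div_iff₀ (he0 k)]
  rw [← Measure.real] at hlay
  linarith


theorem fderiv_bound_ind {n : ℕ} {u : EuclideanSpace ℝ (Fin n) → ℝ} {K : NNReal}
    (hu : LipschitzWith K u) (x : EuclideanSpace ℝ (Fin n)) :
    ‖fderiv ℝ u x‖ ≤ (tsupport u).indicator (fun _ => (K:ℝ)) x := by
  by_cases hx : x ∈ tsupport u
  · rw [indicator_of_mem hx]; exact norm_fderiv_le_of_lipschitz ℝ hu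
  · have : fderiv ℝ u x = 0 := by
      by_contra h
      exact hx (support_fderiv_subset ℝ (f := u) h)
    rw [indicator_of_notMem hx, this, norm_zero]

theorem fderiv_integrable {n : ℕ} {u : EuclideanSpace ℝ (Fin n) → ℝ} {K : NNReal}
    (hu : LipschitzWith K u) (hs : HasCompactSupport u) :
    Integrable (fun x => ‖fderiv ℝ u x‖) volume := by
  refine Integrable.mono' (g := (tsupport u).indicator (fun _ => (K:ℝ))) ?_ 
    (measurable_fderiv ℝ u).norm.aestronglyMeasurable (ae_of_all _ ?_)
  · rw [integrable_indicator_iff hs.isCompact.measurableSet]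
    exact integrableOn_const hs.isCompact.measure_lt_top.ne
  · intro x; rw [norm_norm]; exact fderiv_bound_ind hu x

theorem iso_trunc (n : ℕ) (hn : 0 < n) (u : EuclideanSpace ℝ (Fin n) → ℝ) (K : NNReal)
    (hu : LipschitzWith K u) (hs : HasCompactSupport u) (t1 t2 : ℝ) (ht1 : 0 ≤ t1) (ht : t1 < t2)
    (r : ℝ) (hr : 0 < r) 
    (hvol : volume (Metric.ball (0 : EuclideanSpace ℝ (Fin n)) r) ≤ volume {x | t2 ≤ |u x|}) :
    (t2 - t1) * (n * r ^ (n - 1) * volume.real (Metric.ball (0 : EuclideanSpace ℝ (Fin n)) 1)) ≤ 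
      ∫ x in {x | t1 < |u x| ∧ |u x| < t2}, ‖fderiv ℝ u x‖ := by
  set c := (t2 - t1)⁻¹ with hc
  have hd : 0 < t2 - t1 := by linarith
  have hc0 : 0 < c := by positivity
  set φ : EuclideanSpace ℝ (Fin n) → ℝ := fun x => max 0 (min 1 (c * (|u x| - t1))) with hφ
  set A := {x | t1 < |u x| ∧ |u x| < t2} with hA
  have hAo : IsOpen A := (isOpen_lt continuous_const hu.continuous.abs).inter 
    (isOpen_lt hu.continuous.abs continuous_const)
  have hlip : LipschitzWith (c.toNNReal * K) φ := by
    apply LipschitzWith.const_max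
    apply LipschitzWith.const_min
    apply LipschitzWith.of_dist_le_mul
    intro x y
    have := hu.dist_le_mul x y
    rw [Real.dist_eq] at this ⊢
    have h2 := abs_abs_sub_abs_le_abs_sub (u x) (u y)
    rw [← mul_sub, abs_mul, abs_of_pos hc0]
    push_cast
    rw [Real.coe_toNNReal _ hc0.le, mul_assoc]
    have : |(|u x| - t1 - (|u y| - t1))| ≤ K * dist x y := by
      rw [sub_sub_sub_cancel_right]; linarith
    gcongr
  have hφs : HasCompactSupport φ := by
    apply hs.mono
    intro x hx hx0
    apply hx
    have : c * (|u x| - t1) ≤ 0 := by rw [hx0]; simp; positivity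
    simp only [hφ]
    exact max_eq_left ((min_le_right _ _).trans this)
  have φ0 : ∀ x, 0 ≤ φ x := fun x => le_max_left _ _
  have φ1 : ∀ x, φ x ≤ 1 := fun x => max_le zero_le_one (min_le_left _ _)
  have hone : ∀ x, t2 ≤ |u x| → φ x = 1 := by
    intro x hx
    have : 1 ≤ c * (|u x| - t1) := by
      rw [hc, ← div_eq_inv_mul, one_le_div hd]; linarith
    simp only [hφ]
    rw [min_eq_left this]; simp
  have hzero : ∀ x, |u x| ≤ t1 → φ x = 0 := by
    intro x hx
    have : c * (|u x| - t1) ≤ 0 := mul_nonpos_of_nonneg_of_nonpos hc0.le (by linarith)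
    simp only [hφ]
    exact max_eq_left ((min_le_right _ _).trans this)
  have hmid : ∀ x ∈ A, φ x = c * (|u x| - t1) := by
    intro x hx
    have h1 : c * (|u x| - t1) ≤ 1 := by
      rw [hc, ← div_eq_inv_mul, div_le_one hd]; linarith [hx.2]
    have h2 : 0 ≤ c * (|u x| - t1) := mul_nonneg hc0.le (by linarith [hx.1])
    simp only [hφ]
    rw [min_eq_right h1, max_eq_right h2]
  have key := iso_fun n hn φ _ hlip hφs φ0 φ1 r hr (hvol.trans (measure_mono fun x hx => (hone x hx).ge))
  have hIntg := fderiv_integrable hu hs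
  have hb : ∀ᵐ x, ‖fderiv ℝ φ x‖ ≤ A.indicator (fun x => c * ‖fderiv ℝ u x‖) x := by
    filter_upwards [hu.ae_differentiableAt] with x hx
    by_cases hxA : x ∈ A
    · rw [indicator_of_mem hxA]
      have hux : u x ≠ 0 := by
        intro h; have := hxA.1; rw [h] at this; simp at this; linarith
      obtain ⟨σ, hσ, hσe⟩ : ∃ σ : ℝ, |σ| = 1 ∧ ∀ᶠ y in 𝓝 x, |u y| = σ * u y := by
        rcases lt_or_gt_of_ne hux with h | h
        · refine ⟨-1, by simp, ?_⟩
          filter_upwards [hu.continuous.continuousAt.eventually_lt continuousAt_const h] with y hy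
          rw [abs_of_neg hy]; ring
        · refine ⟨1, by simp, ?_⟩
          filter_upwards [continuousAt_const.eventually_lt hu.continuous.continuousAt h] with y hy
          rw [abs_of_pos hy]; ring
      have heq : φ =ᶠ[𝓝 x] fun y => c * (σ * u y - t1) := by
        filter_upwards [hσe, hAo.mem_nhds hxA] with y hy hyA
        rw [hmid y hyA, hy]
      have hfd : HasFDerivAt (fun y => c * (σ * u y - t1)) (c • (σ • fderiv ℝ u x)) x :=
        ((hx.hasFDerivAt.const_mul σ).sub_const t1).const_mul c
      rw [heq.fderiv_eq, hfd.fderiv, norm_smul, norm_smul, Real.norm_eq_abs, Real.norm_eq_abs, hσ,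
        one_mul, abs_of_pos hc0]
    · rw [indicator_of_notMem hxA]
      have : fderiv ℝ φ x = 0 := by
        by_cases h1 : |u x| ≤ t1
        · apply IsLocalMin.fderiv_eq_zero
          exact Eventually.of_forall fun y => by rw [hzero x h1]; exact φ0 y
        · have h2 : t2 ≤ |u x| := by
            by_contra h
            exact hxA ⟨not_le.1 h1, not_le.1 h⟩
          apply IsLocalMax.fderiv_eq_zero
          exact Eventually.of_forall fun y => by rw [hone x h2]; exact φ1 y
      rw [this, norm_zero]
  have h3 : ∫ x, ‖fderiv ℝ φ x‖ ≤ ∫ x, A.indicator (fun x => c * ‖fderiv ℝ u x‖) x :=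
    integral_mono_ae (fderiv_integrable hlip hφs) ((hIntg.const_mul c).indicator hAo.measurableSet) hb
  rw [integral_indicator hAo.measurableSet, integral_const_mul] at h3
  have h4 := key.trans h3
  rw [hc, ← div_eq_inv_mul, le_div_iff₀ hd] at h4
  linarith


/-- The measure with density `g`. -/
noncomputable def nuG (n : ℕ) (g : EuclideanSpace ℝ (Fin n) → ℝ) :
    Measure (EuclideanSpace ℝ (Fin n)) :=
  volume.withDensity (fun x => ENNReal.ofReal (g x))

theorem muG_eq (n : ℕ) (g : EuclideanSpace ℝ (Fin n) → ℝ) (A : Set (EuclideanSpace ℝ (Fin n))) :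
    muG n g A = nuG n g A := by
  rw [muG, nuG, withDensity_apply']

/-- The radial profile of the rearrangement. -/
noncomputable def rho (n : ℕ) (g u : EuclideanSpace ℝ (Fin n) → ℝ) (r : ℝ) : ℝ :=
  sSup {t : ℝ | 0 ≤ t ∧ nuG n g (Metric.ball 0 r) < nuG n g {x | t < |u x|}}

theorem rearrG_eq (n : ℕ) (g u : EuclideanSpace ℝ (Fin n) → ℝ) (x : EuclideanSpace ℝ (Fin n)) :
    rearrG n g u x = rho n g u ‖x‖ := by
  simp only [rearrG, rho, distG, muG_eq]

section
variable {n : ℕ} {g u : EuclideanSpace ℝ (Fin n) → ℝ}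

theorem nuG_compact (hg : LocallyIntegrable g volume) {S : Set (EuclideanSpace ℝ (Fin n))}
    (hS : IsCompact S) : nuG n g S < ⊤ := by
  rw [nuG, withDensity_apply']
  refine lt_of_le_of_lt (lintegral_mono fun x => ?_) (hg.integrableOn_isCompact hS).2
  exact Real.ofReal_le_enorm _

theorem nuG_ball (hg : LocallyIntegrable g volume) (r : ℝ) : nuG n g (Metric.ball 0 r) < ⊤ :=
  (measure_mono Metric.ball_subset_closedBall).trans_lt (nuG_compact hg (isCompact_closedBall 0 r))

theorem nuG_level (hg : LocallyIntegrable g volume) (hs : HasCompactSupport u) (t : ℝ)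
    (ht : 0 ≤ t) : nuG n g {x | t < |u x|} < ⊤ := by
  refine (measure_mono ?_).trans_lt (nuG_compact hg hs.isCompact)
  intro x hx
  apply subset_tsupport
  intro h
  have : t < |u x| := hx
  rw [h, abs_zero] at this
  linarith

theorem u_bdd (hu : Continuous u) (hs : HasCompactSupport u) : ∃ M, 0 ≤ M ∧ ∀ x, |u x| ≤ M := by
  obtain ⟨C, hC⟩ := hs.exists_bound_of_continuous hu
  exact ⟨C, (norm_nonneg _).trans (hC 0), hC⟩

theorem rho_nonneg (r : ℝ) : 0 ≤ rho n g u r := Real.sSup_nonneg fun _ h => h.1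

theorem level_sup (t : ℝ) : nuG n g {x | t < |u x|} =
    ⨆ k : ℕ, nuG n g {x | t + 1 / ((k:ℝ) + 1) < |u x|} := by
  rw [← Monotone.measure_iUnion]
  · congr 1
    ext x
    simp only [mem_ofPred_eq, mem_iUnion]
    constructor
    · intro h
      obtain ⟨k, hk⟩ := exists_nat_one_div_lt (sub_pos.2 h)
      exact ⟨k, by linarith⟩
    · rintro ⟨k, hk⟩
      have : 0 < 1 / ((k:ℝ) + 1) := by positivity
      linarith
  · intro i j hij x hx
    have : 1 / ((j:ℝ) + 1) ≤ 1 / ((i:ℝ) + 1) := by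
      gcongr
    simp only [mem_ofPred_eq] at hx ⊢
    linarith

theorem lt_rho_iff (hu : Continuous u) (hs : HasCompactSupport u) (r t : ℝ) (ht : 0 ≤ t) :
    t < rho n g u r ↔ nuG n g (Metric.ball 0 r) < nuG n g {x | t < |u x|} := by
  constructor
  · intro h
    have hne : {t : ℝ | 0 ≤ t ∧ nuG n g (Metric.ball 0 r) < nuG n g {x | t < |u x|}}.Nonempty := by
      by_contra hc
      rw [not_nonempty_iff_eq_empty] at hc
      rw [rho, hc, Real.sSup_empty] at h
      linarith
    obtain ⟨t', ⟨_, h1⟩, h2⟩ := exists_lt_of_lt_csSup hne h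
    exact h1.trans_le (measure_mono fun x hx => h2.trans hx)
  · intro h
    rw [level_sup] at h
    obtain ⟨k, hk⟩ := lt_iSup_iff.1 h
    have h0 : 0 < 1 / ((k:ℝ) + 1) := by positivity
    refine lt_of_lt_of_le (by linarith : t < t + 1 / ((k:ℝ) + 1)) (le_csSup ?_ ⟨by linarith, hk⟩)
    obtain ⟨M, hM, hb⟩ := u_bdd hu hs
    refine ⟨M, ?_⟩
    rintro s ⟨_, hs2⟩
    by_contra hc
    have : {x | s < |u x|} = ∅ := by
      ext x; simp; linarith [hb x]
    simp [this] at hs2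

theorem level_rho_le (hu : Continuous u) (hs : HasCompactSupport u) (r : ℝ) :
    nuG n g {x | rho n g u r < |u x|} ≤ nuG n g (Metric.ball 0 r) := by
  have := (lt_rho_iff (g := g) hu hs r _ (rho_nonneg (n := n) (g := g) (u := u) r)).not
  simpa using this

theorem rho_antitone (hu : Continuous u) (hs : HasCompactSupport u) : Antitone (rho n g u) := by
  intro r r' hrr
  by_contra h
  have h1 := (lt_rho_iff hu hs r' _ (rho_nonneg r)).1 (not_le.1 h)
  have h2 := level_rho_le (g := g) hu hs r
  exact absurd (h1.trans_le h2) (not_lt.2 (measure_mono (Metric.ball_subset_ball hrr)))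

theorem le_level_rho (hg : LocallyIntegrable g volume) (hu : Continuous u)
    (hs : HasCompactSupport u) (r : ℝ) (hr : 0 < rho n g u r) :
    nuG n g (Metric.ball 0 r) ≤ nuG n g {x | rho n g u r ≤ |u x|} := by
  set ρ := rho n g u r
  have hseq : {x | ρ ≤ |u x|} = ⋂ k : ℕ, {x | ρ - ρ / ((k:ℝ) + 1) < |u x|} := by
    ext x
    simp only [mem_ofPred_eq, mem_iInter]
    constructor
    · intro h k
      have : 0 < ρ / ((k:ℝ) + 1) := by positivity
      linarith
    · intro h
      have ht : Tendsto (fun k : ℕ => ρ - ρ / ((k:ℝ) + 1)) atTop (𝓝 (ρ - ρ * 0)) := by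
        have := (tendsto_one_div_add_atTop_nhds_zero_nat (𝕜 := ℝ)).const_mul ρ
        simp only [mul_one_div] at this
        exact tendsto_const_nhds.sub this
      simp only [mul_zero, sub_zero] at ht
      exact le_of_tendsto' ht fun k => (h k).le
  have hnn : ∀ k : ℕ, 0 ≤ ρ - ρ / ((k:ℝ) + 1) := by
    intro k
    have : ρ / ((k:ℝ) + 1) ≤ ρ := div_le_self hr.le (by linarith [(Nat.cast_nonneg k : (0:ℝ) ≤ k)])
    linarith
  rw [hseq, Antitone.measure_iInter]
  · refine le_iInf fun k => ?_
    refine ((lt_rho_iff hu hs r _ (hnn k)).1 ?_).le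
    have : 0 < ρ / ((k:ℝ) + 1) := by positivity
    show _ < ρ
    linarith
  · intro i j hij x hx
    have : ρ / ((j:ℝ) + 1) ≤ ρ / ((i:ℝ) + 1) := by gcongr
    simp only [mem_ofPred_eq] at hx ⊢
    linarith
  · intro k
    exact (measurableSet_lt measurable_const hu.abs.measurable).nullMeasurableSet
  · exact ⟨0, (nuG_level hg hs _ (hnn 0)).ne⟩

end

theorem bathtub {α : Type*} [MeasurableSpace α] (lam : Measure α) (w : α → ENNReal) (c : ENNReal)
    (S T : Set α) (hS : MeasurableSet S) (hT : MeasurableSet T) (hST : lam S ≤ lam T)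
    (hfin : lam S ≠ ⊤) (h1 : ∀ᵐ x ∂lam, x ∉ T → w x ≤ c) (h2 : ∀ᵐ x ∂lam, x ∈ T → c ≤ w x) :
    ∫⁻ x in S, w x ∂lam ≤ ∫⁻ x in T, w x ∂lam := by
  have hd : lam (S \ T) ≤ lam (T \ S) := by
    have e1 := measure_inter_add_sdiff (μ := lam) S hT
    have e2 := measure_inter_add_sdiff (μ := lam) T hS
    rw [← e1, ← e2, inter_comm T S] at hST
    exact (ENNReal.add_le_add_iff_left (ne_top_of_le_ne_top hfin (measure_mono inter_subset_left))).1 hST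
  rw [← lintegral_inter_add_sdiff w S hT, ← lintegral_inter_add_sdiff w T hS, inter_comm T S]
  refine add_le_add le_rfl ?_
  calc ∫⁻ x in S \ T, w x ∂lam ≤ ∫⁻ x in S \ T, c ∂lam := by
        apply lintegral_mono_ae
        rw [ae_restrict_iff' (hS.diff hT)]
        filter_upwards [h1] with x hx hx2 using hx hx2.2
    _ = c * lam (S \ T) := by simp
    _ ≤ c * lam (T \ S) := by gcongr
    _ = ∫⁻ x in T \ S, c ∂lam := by simp
    _ ≤ _ := by
        apply lintegral_mono_ae
        rw [ae_restrict_iff' (hT.diff hS)]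
        filter_upwards [h2] with x hx hx2 using hx hx2.1


section
variable {n : ℕ} {g u : EuclideanSpace ℝ (Fin n) → ℝ}

/-- A unit vector. -/
noncomputable def unitV (n : ℕ) (hn : 0 < n) : EuclideanSpace ℝ (Fin n) :=
  EuclideanSpace.single ⟨0, hn⟩ 1

theorem norm_smul_unitV (hn : 0 < n) (r : ℝ) (hr : 0 ≤ r) : ‖r • unitV n hn‖ = r := by
  rw [norm_smul, unitV]; simp [abs_of_nonneg hr]

theorem smul_unitV_ne (hn : 0 < n) (r : ℝ) (hr : 0 < r) : r • unitV n hn ≠ 0 := by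
  rw [← norm_ne_zero_iff, norm_smul_unitV hn r hr.le]; exact hr.ne'

/-- The radial profile of `g`. -/
noncomputable def prof (n : ℕ) (hn : 0 < n) (g : EuclideanSpace ℝ (Fin n) → ℝ) (r : ℝ) : ℝ :=
  g (r • unitV n hn)

theorem prof_eq (hn : 0 < n) (hg : Admissible n g) (x : EuclideanSpace ℝ (Fin n)) :
    g x = prof n hn g ‖x‖ :=
  hg.2.1 _ _ (norm_smul_unitV hn _ (norm_nonneg _)).symm

theorem prof_anti (hn : 0 < n) (hg : Admissible n g) : AntitoneOn (prof n hn g) (Ioi 0) := by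
  intro a ha b hb hab
  apply hg.2.2.2.2 _ _ (smul_unitV_ne hn a ha) (smul_unitV_ne hn b hb)
  rwa [norm_smul_unitV hn a (le_of_lt ha), norm_smul_unitV hn b (le_of_lt hb)]

theorem prof_pos (hn : 0 < n) (hgpos : ∀ x : EuclideanSpace ℝ (Fin n), x ≠ 0 → 0 < g x) (r : ℝ)
    (hr : 0 < r) : 0 < prof n hn g r := hgpos _ (smul_unitV_ne hn r hr)

theorem ae_ne_zero (hn : 0 < n) : ∀ᵐ x : EuclideanSpace ℝ (Fin n), x ≠ 0 := by
  have : Nonempty (Fin n) := ⟨⟨0, hn⟩⟩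
  rw [ae_iff]; simp

theorem vol_ball (hn : 0 < n) (a : ℝ) (ha : 0 ≤ a) :
    volume (Metric.ball (0 : EuclideanSpace ℝ (Fin n)) a) =
      ENNReal.ofReal (a ^ n * volume.real (Metric.ball (0 : EuclideanSpace ℝ (Fin n)) 1)) := by
  have : Nonempty (Fin n) := ⟨⟨0, hn⟩⟩
  rw [Measure.addHaar_ball _ _ ha, ENNReal.ofReal_mul (by positivity), Measure.real,
    ENNReal.ofReal_toReal measure_ball_lt_top.ne]
  simp

theorem g_meas (hg : Admissible n g) : AEMeasurable g volume :=
  hg.1.aestronglyMeasurable.aemeasurable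

theorem vol_ac (hn : 0 < n) (hg : Admissible n g)
    (hgpos : ∀ x : EuclideanSpace ℝ (Fin n), x ≠ 0 → 0 < g x) : volume ≪ nuG n g := by
  apply withDensity_absolutelyContinuous' (g_meas hg).ennreal_ofReal
  filter_upwards [ae_ne_zero hn] with x hx
  simpa using hgpos x hx

theorem nuG_ball_strict (hn : 0 < n) (hg : Admissible n g)
    (hgpos : ∀ x : EuclideanSpace ℝ (Fin n), x ≠ 0 → 0 < g x) (a b : ℝ) (ha : 0 ≤ a) (hab : a < b) :
    nuG n g (Metric.ball 0 a) < nuG n g (Metric.ball 0 b) := by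
  refine lt_of_le_of_ne (measure_mono (Metric.ball_subset_ball hab.le)) ?_
  intro h
  have h1 : nuG n g (Metric.ball 0 b \ Metric.ball 0 a) = 0 := by
    rw [measure_sdiff (Metric.ball_subset_ball hab.le) Metric.isOpen_ball.nullMeasurableSet
      (nuG_ball hg.1 a).ne, h, tsub_self]
  have h2 := vol_ac hn hg hgpos h1
  rw [measure_sdiff (Metric.ball_subset_ball hab.le) Metric.isOpen_ball.nullMeasurableSet
      measure_ball_lt_top.ne, tsub_eq_zero_iff_le, vol_ball hn a ha, vol_ball hn b (by linarith),
      ENNReal.ofReal_le_ofReal_iff (by positivity)] at h2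
  have h3 : 0 < volume.real (Metric.ball (0 : EuclideanSpace ℝ (Fin n)) 1) :=
    ENNReal.toReal_pos (Metric.measure_ball_pos _ _ one_pos).ne' measure_ball_lt_top.ne
  have h4 := le_of_mul_le_mul_right h2 h3
  exact absurd h4 (not_le.2 (pow_lt_pow_left₀ hab ha hn.ne'))

theorem nuG_ball_add (hn : 0 < n) (hg : Admissible n g) (a b : ℝ) (ha : 0 < a) (hab : a ≤ b) :
    nuG n g (Metric.ball 0 b) ≤ nuG n g (Metric.ball 0 a) + ENNReal.ofReal (prof n hn g a *
      (volume.real (Metric.ball (0 : EuclideanSpace ℝ (Fin n)) 1) * (b ^ n - a ^ n))) := by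
  have h0 : 0 ≤ prof n hn g a := hg.2.2.2.1 _ (smul_unitV_ne hn a ha)
  have hsub := Metric.ball_subset_ball (x := (0 : EuclideanSpace ℝ (Fin n))) hab
  have hmd : MeasurableSet (Metric.ball (0 : EuclideanSpace ℝ (Fin n)) b \ Metric.ball 0 a) :=
    Metric.isOpen_ball.measurableSet.diff Metric.isOpen_ball.measurableSet
  have hd : nuG n g (Metric.ball 0 b \ Metric.ball 0 a) ≤ ENNReal.ofReal (prof n hn g a *
      (volume.real (Metric.ball (0 : EuclideanSpace ℝ (Fin n)) 1) * (b ^ n - a ^ n))) := by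
    rw [nuG, withDensity_apply']
    calc _ ≤ ∫⁻ x in Metric.ball (0 : EuclideanSpace ℝ (Fin n)) b \ Metric.ball 0 a,
          ENNReal.ofReal (prof n hn g a) := by
          apply lintegral_mono_ae
          rw [ae_restrict_iff' hmd]
          refine ae_of_all _ fun x hx => ?_
          have hx2 : a ≤ ‖x‖ := by simpa using hx.2
          rw [prof_eq hn hg x]
          exact ENNReal.ofReal_le_ofReal (prof_anti hn hg ha (lt_of_lt_of_le ha hx2) hx2)
      _ = _ := by
          rw [setLIntegral_const, measure_sdiff hsub Metric.isOpen_ball.nullMeasurableSet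
            measure_ball_lt_top.ne, vol_ball hn a ha.le, vol_ball hn b (by linarith),
            ← ENNReal.ofReal_sub _ (by positivity), ← ENNReal.ofReal_mul h0]
          congr 1; ring
  calc _ = nuG n g (Metric.ball 0 a ∪ (Metric.ball 0 b \ Metric.ball 0 a)) := by
        rw [union_sdiff_cancel hsub]
    _ ≤ _ := (measure_union_le _ _).trans (by gcongr)

theorem vol_level (hn : 0 < n) (hg : Admissible n g)
    (hgpos : ∀ x : EuclideanSpace ℝ (Fin n), x ≠ 0 → 0 < g x) (hu : Continuous u)
    (hs : HasCompactSupport u) (r : ℝ) (hr : 0 < r) (hρ : 0 < rho n g u r) :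
    volume (Metric.ball (0 : EuclideanSpace ℝ (Fin n)) r) ≤ volume {x | rho n g u r ≤ |u x|} := by
  by_contra hc
  rw [not_le] at hc
  set S := {x | rho n g u r ≤ |u x|} with hS
  have hSm : MeasurableSet S := measurableSet_le measurable_const hu.abs.measurable
  obtain ⟨a, ha0, har, ha⟩ : ∃ a, 0 < a ∧ a < r ∧
      volume S ≤ volume (Metric.ball (0 : EuclideanSpace ℝ (Fin n)) a) := by
    have ht : Tendsto (fun a : ℝ => volume (Metric.ball (0 : EuclideanSpace ℝ (Fin n)) a)) (𝓝[<] r)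
        (𝓝 (volume (Metric.ball (0 : EuclideanSpace ℝ (Fin n)) r))) := by
      rw [vol_ball hn r hr.le]
      have h1 : Tendsto (fun a : ℝ => ENNReal.ofReal
        (a ^ n * volume.real (Metric.ball (0 : EuclideanSpace ℝ (Fin n)) 1))) (𝓝[<] r)
        (𝓝 (ENNReal.ofReal (r ^ n * volume.real (Metric.ball (0 : EuclideanSpace ℝ (Fin n)) 1)))) := by
        apply ENNReal.tendsto_ofReal
        exact (Continuous.tendsto (by fun_prop) r).mono_left nhdsWithin_le_nhds
      refine h1.congr' ?_
      filter_upwards [Ioo_mem_nhdsLT hr] with a ha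
      rw [vol_ball hn a ha.1.le]
    obtain ⟨a, h1, h2⟩ := ((ht.eventually (lt_mem_nhds hc)).and (Ioo_mem_nhdsLT hr)).exists
    exact ⟨a, h2.1, h2.2, h1.le⟩
  have h1 : nuG n g S ≤ nuG n g (Metric.ball 0 a) := by
    rw [nuG, withDensity_apply', withDensity_apply']
    apply bathtub volume _ (ENNReal.ofReal (prof n hn g a)) S _ hSm Metric.isOpen_ball.measurableSet
      ha (ne_top_of_le_ne_top measure_ball_lt_top.ne ha)
    · refine ae_of_all _ fun x hx => ?_
      have hx2 : a ≤ ‖x‖ := by simpa using hx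
      rw [prof_eq hn hg x]
      exact ENNReal.ofReal_le_ofReal (prof_anti hn hg ha0 (lt_of_lt_of_le ha0 hx2) hx2)
    · filter_upwards [ae_ne_zero hn] with x hx0 hx
      have hx2 : ‖x‖ < a := by simpa using hx
      rw [prof_eq hn hg x]
      exact ENNReal.ofReal_le_ofReal (prof_anti hn hg (norm_pos_iff.2 hx0) ha0 hx2.le)
  have h2 := le_level_rho hg.1 hu hs r hρ
  exact absurd (nuG_ball_strict hn hg hgpos a r ha0.le har) (not_lt.2 (h2.trans h1))

theorem nu_ring (hn : 0 < n) (hg : Admissible n g) (hu : Continuous u)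
    (hs : HasCompactSupport u) (a b : ℝ) (ha : 0 < a) (hab : a ≤ b)
    (hρ : rho n g u b < rho n g u a) :
    nuG n g {x | rho n g u b < |u x| ∧ |u x| < rho n g u a} ≤ ENNReal.ofReal (prof n hn g a *
      (volume.real (Metric.ball (0 : EuclideanSpace ℝ (Fin n)) 1) * (b ^ n - a ^ n))) := by
  have h1 := le_level_rho hg.1 hu hs a ((rho_nonneg b).trans_lt hρ)
  have h2 := level_rho_le (g := g) hu hs b
  have h3 := nuG_ball_add hn hg a b ha hab
  have h4 : nuG n g {x | rho n g u b < |u x| ∧ |u x| < rho n g u a} +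
      nuG n g {x | rho n g u a ≤ |u x|} ≤ nuG n g {x | rho n g u b < |u x|} := by
    rw [← measure_union]
    · apply measure_mono
      rintro x (hx | hx)
      · exact hx.1
      · exact hρ.trans_le hx
    · rw [disjoint_left]
      intro x hx hx2
      exact absurd hx.2 (not_lt.2 hx2)
    · exact measurableSet_le measurable_const hu.abs.measurable
  have h5 : nuG n g (Metric.ball 0 a) + nuG n g {x | rho n g u b < |u x| ∧ |u x| < rho n g u a} ≤
      nuG n g (Metric.ball 0 a) + ENNReal.ofReal (prof n hn g a *
      (volume.real (Metric.ball (0 : EuclideanSpace ℝ (Fin n)) 1) * (b ^ n - a ^ n))) := by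
    refine le_trans ?_ (h4.trans (h2.trans h3))
    rw [add_comm]
    gcongr
  exact (ENNReal.add_le_add_iff_left (nuG_ball hg.1 a).ne).1 h5

end


theorem tangent_ineq (a c l p : ℝ) (ha : 0 ≤ a) (hc : 0 < c) (hl : 0 < l) (hp : 1 ≤ p) :
    p * l ^ (p - 1) * a - (p - 1) * l ^ p * c ≤ a ^ p * c ^ (1 - p) := by
  have hz : 0 ≤ a / (c * l) := by positivity
  have h := one_add_mul_self_le_rpow_one_add (s := a / (c * l) - 1) (by linarith) hp
  rw [add_sub_cancel] at h
  have h2 := mul_le_mul_of_nonneg_left h (by positivity : 0 ≤ l ^ p * c)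
  have e1 : l ^ p * c * (a / (c * l)) ^ p = a ^ p * c ^ (1 - p) := by
    rw [Real.div_rpow ha (by positivity), Real.mul_rpow hc.le hl.le, Real.rpow_sub hc, Real.rpow_one]
    have := Real.rpow_pos_of_pos hl p
    have := Real.rpow_pos_of_pos hc p
    field_simp
  have e2 : l ^ p * c * (1 + p * (a / (c * l) - 1)) =
      p * l ^ (p - 1) * a - (p - 1) * l ^ p * c := by
    rw [Real.rpow_sub hl, Real.rpow_one]
    field_simp
    ring
  linarith

theorem deriv_nonneg_of_right (Φ : ℝ → ℝ) (d r : ℝ) (h : HasDerivAt Φ d r)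
    (hm : ∀ s, r < s → Φ r ≤ Φ s) : 0 ≤ d := by
  have h1 := (hasDerivAt_iff_tendsto_slope.1 h).mono_left
    (nhdsWithin_mono r (fun s (hs : s ∈ Ioi r) => (ne_of_gt hs : s ≠ r)))
  refine ge_of_tendsto h1 ?_
  filter_upwards [self_mem_nhdsWithin] with s hs
  rw [slope_def_field]
  exact div_nonneg (sub_nonneg.2 (hm s hs)) (sub_nonneg.2 (le_of_lt hs))

section
variable {n : ℕ} {g u : EuclideanSpace ℝ (Fin n) → ℝ}

/-- The Dirichlet-type integrand. -/
noncomputable def enG (n : ℕ) (p : ℝ) (g u : EuclideanSpace ℝ (Fin n) → ℝ)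
    (x : EuclideanSpace ℝ (Fin n)) : ℝ := ‖fderiv ℝ u x‖ ^ p * g x ^ (1 - p)

theorem enG_nonneg (hn : 0 < n) (p : ℝ) 
    (hgpos : ∀ x : EuclideanSpace ℝ (Fin n), x ≠ 0 → 0 < g x) : ∀ᵐ x, 0 ≤ enG n p g u x := by
  filter_upwards [ae_ne_zero hn] with x hx
  exact mul_nonneg (Real.rpow_nonneg (norm_nonneg _) _) (Real.rpow_nonneg (hgpos x hx).le _)

theorem enG_integrable (hn : 0 < n) (p : ℝ) (hp : 1 ≤ p) (hg : Admissible n g)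
    (hgpos : ∀ x : EuclideanSpace ℝ (Fin n), x ≠ 0 → 0 < g x) {K : NNReal}
    (hu : LipschitzWith K u) (hs : HasCompactSupport u) : Integrable (enG n p g u) volume := by
  obtain ⟨R, hR0, hR⟩ : ∃ R > 0, tsupport u ⊆ Metric.closedBall 0 R := by
    obtain ⟨R, hR⟩ := hs.isCompact.isBounded.subset_closedBall 0
    exact ⟨max R 1, by positivity, hR.trans (Metric.closedBall_subset_closedBall (le_max_left _ _))⟩
  refine Integrable.mono' (g := (tsupport u).indicator 
    (fun _ => (K:ℝ) ^ p * prof n hn g R ^ (1 - p))) ?_ ?_ ?_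
  · rw [integrable_indicator_iff hs.isCompact.measurableSet]
    exact integrableOn_const hs.isCompact.measure_lt_top.ne
  · exact (((measurable_fderiv ℝ u).norm.pow_const p).aemeasurable.mul 
      ((g_meas hg).pow_const _)).aestronglyMeasurable
  · filter_upwards [ae_ne_zero hn, enG_nonneg (u := u) hn p hgpos] with x hx hx2
    rw [norm_of_nonneg hx2]
    have hb := fderiv_bound_ind hu x
    by_cases hxs : x ∈ tsupport u
    · rw [indicator_of_mem hxs] at hb ⊢
      have hxR : ‖x‖ ≤ R := by simpa using hR hxs
      unfold enG
      have h1 : g x ^ (1 - p) ≤ prof n hn g R ^ (1 - p) := by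
        apply Real.rpow_le_rpow_of_nonpos (prof_pos hn hgpos R hR0) _ (by linarith)
        rw [prof_eq hn hg x]
        exact prof_anti hn hg (norm_pos_iff.2 hx) hR0 hxR
      have h2 : 0 ≤ g x ^ (1 - p) := Real.rpow_nonneg (hgpos x hx).le _
      gcongr
    · rw [indicator_of_notMem hxs] at hb ⊢
      have : ‖fderiv ℝ u x‖ = 0 := le_antisymm hb (norm_nonneg _)
      unfold enG
      rw [this, Real.zero_rpow (by linarith), zero_mul]

/-- Energy above the level `rho r`. -/
noncomputable def FF (n : ℕ) (p : ℝ) (g u : EuclideanSpace ℝ (Fin n) → ℝ) (r : ℝ) : ℝ :=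
  ∫ x in {x | rho n g u r < |u x|}, enG n p g u x

theorem FF_step (hn : 0 < n) (p : ℝ) (hp : 1 ≤ p) (hg : Admissible n g)
    (hgpos : ∀ x : EuclideanSpace ℝ (Fin n), x ≠ 0 → 0 < g x) {K : NNReal}
    (hu : LipschitzWith K u) (hs : HasCompactSupport u) (a b l : ℝ) (ha : 0 < a) (hab : a ≤ b)
    (hl : 0 < l) :
    p * l ^ (p - 1) * ((rho n g u a - rho n g u b) *
      (n * a ^ (n - 1) * volume.real (Metric.ball (0 : EuclideanSpace ℝ (Fin n)) 1))) -
      (p - 1) * l ^ p * (prof n hn g a *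
      (volume.real (Metric.ball (0 : EuclideanSpace ℝ (Fin n)) 1) * (b ^ n - a ^ n)))
      ≤ FF n p g u b - FF n p g u a := by
  set ω := volume.real (Metric.ball (0 : EuclideanSpace ℝ (Fin n)) 1) with hω
  have hω0 : 0 ≤ ω := measureReal_nonneg
  have hpa : 0 < prof n hn g a := prof_pos hn hgpos a ha
  have hpow : 0 ≤ b ^ n - a ^ n := sub_nonneg.2 (pow_le_pow_left₀ ha.le hab n)
  have hlp : 0 < l ^ p := Real.rpow_pos_of_pos hl p
  have hlp1 : 0 < l ^ (p - 1) := Real.rpow_pos_of_pos hl _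
  rcases (rho_antitone (g := g) hu.continuous hs hab).eq_or_lt with heq | hlt
  · have : FF n p g u b = FF n p g u a := by unfold FF; rw [heq]
    rw [this, heq, sub_self, sub_self, zero_mul, mul_zero, zero_sub, neg_nonpos]
    have : 0 ≤ p - 1 := by linarith
    positivity
  · set A := {x | rho n g u b < |u x| ∧ |u x| < rho n g u a} with hA
    have hAm : MeasurableSet A := ((isOpen_lt continuous_const hu.continuous.abs).inter 
      (isOpen_lt hu.continuous.abs continuous_const)).measurableSet
    have hiso := iso_trunc n hn u K hu hs _ _ (rho_nonneg b) hlt a ha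
      (vol_level hn hg hgpos hu.continuous hs a ha ((rho_nonneg b).trans_lt hlt))
    have hring := nu_ring hn hg hu.continuous hs a b ha hab hlt
    have hAsub : A ⊆ tsupport u := by
      intro x hx
      apply subset_tsupport
      intro h
      have := hx.1
      rw [h, abs_zero] at this
      linarith [rho_nonneg (n := n) (g := g) (u := u) b]
    have hgi : IntegrableOn g A volume := (hg.1.integrableOn_isCompact hs.isCompact).mono_set hAsub
    have hgA : ∫ x in A, g x ≤ prof n hn g a * (ω * (b ^ n - a ^ n)) := by
      rw [integral_eq_lintegral_of_nonneg_ae _ hgi.aestronglyMeasurable]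
      · apply ENNReal.toReal_le_of_le_ofReal (by positivity)
        rw [nuG, withDensity_apply'] at hring
        exact hring
      · refine ae_restrict_of_ae ?_
        filter_upwards [ae_ne_zero hn] with x hx using (hgpos x hx).le
    have hGi := enG_integrable hn p hp hg hgpos hu hs
    have hfi := fderiv_integrable hu hs
    have hI : p * l ^ (p - 1) * (∫ x in A, ‖fderiv ℝ u x‖) - (p - 1) * l ^ p * (∫ x in A, g x) ≤
        ∫ x in A, enG n p g u x := by
      rw [← integral_const_mul, ← integral_const_mul, 
        ← integral_sub (hfi.integrableOn.const_mul _) (hgi.const_mul _)]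
      apply integral_mono_ae ((hfi.integrableOn.const_mul _).sub (hgi.const_mul _)) hGi.integrableOn
      refine ae_restrict_of_ae ?_
      filter_upwards [ae_ne_zero hn] with x hx
      exact tangent_ineq _ _ l p (norm_nonneg _) (hgpos x hx) hl hp
    have hF : (∫ x in A, enG n p g u x) + FF n p g u a ≤ FF n p g u b := by
      unfold FF
      rw [← setIntegral_union _ (measurableSet_lt measurable_const hu.continuous.abs.measurable)
        hGi.integrableOn hGi.integrableOn]
      · apply setIntegral_mono_set hGi.integrableOn (ae_restrict_of_ae (enG_nonneg hn p hgpos))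
        refine (HasSubset.Subset.eventuallyLE ?_)
        rintro x (hx | hx)
        · exact hx.1
        · exact hlt.trans hx
      · rw [disjoint_left]
        intro x hx hx2
        exact lt_asymm hx.2 hx2
    have h1 := mul_le_mul_of_nonneg_left hiso (by positivity : 0 ≤ p * l ^ (p - 1))
    have h2 := mul_le_mul_of_nonneg_left hgA (mul_nonneg (by linarith) hlp.le : 0 ≤ (p - 1) * l ^ p)
    linarith

theorem FF_mono (hn : 0 < n) (p : ℝ) (hp : 1 ≤ p) (hg : Admissible n g)
    (hgpos : ∀ x : EuclideanSpace ℝ (Fin n), x ≠ 0 → 0 < g x) {K : NNReal}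
    (hu : LipschitzWith K u) (hs : HasCompactSupport u) : Monotone (FF n p g u) := by
  intro a b hab
  apply setIntegral_mono_set (enG_integrable hn p hp hg hgpos hu hs).integrableOn
    (ae_restrict_of_ae (enG_nonneg hn p hgpos))
  refine (HasSubset.Subset.eventuallyLE ?_)
  intro x hx
  exact lt_of_le_of_lt (rho_antitone (g := g) hu.continuous hs hab) hx

theorem FF_bd (hn : 0 < n) (p : ℝ) (hp : 1 ≤ p) (hg : Admissible n g)
    (hgpos : ∀ x : EuclideanSpace ℝ (Fin n), x ≠ 0 → 0 < g x) {K : NNReal}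
    (hu : LipschitzWith K u) (hs : HasCompactSupport u) (r : ℝ) : 
    0 ≤ FF n p g u r ∧ FF n p g u r ≤ ∫ x, enG n p g u x :=
  ⟨integral_nonneg_of_ae (ae_restrict_of_ae (enG_nonneg hn p hgpos)),
    setIntegral_le_integral (enG_integrable hn p hp hg hgpos hu hs) (enG_nonneg hn p hgpos)⟩

theorem FF_deriv (hn : 0 < n) (p : ℝ) (hp : 1 ≤ p) (hg : Admissible n g)
    (hgpos : ∀ x : EuclideanSpace ℝ (Fin n), x ≠ 0 → 0 < g x) {K : NNReal}
    (hu : LipschitzWith K u) (hs : HasCompactSupport u) (r : ℝ) (hr : 0 < r)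
    (h1 : DifferentiableAt ℝ (rho n g u) r) (h2 : DifferentiableAt ℝ (FF n p g u) r) :
    n * r ^ (n - 1) * volume.real (Metric.ball (0 : EuclideanSpace ℝ (Fin n)) 1) *
      (|deriv (rho n g u) r| ^ p * prof n hn g r ^ (1 - p)) ≤ deriv (FF n p g u) r := by
  set ω := volume.real (Metric.ball (0 : EuclideanSpace ℝ (Fin n)) 1) with hω
  have hω0 : 0 ≤ ω := measureReal_nonneg
  set d := deriv (rho n g u) r with hd
  have hd0 : d ≤ 0 := (rho_antitone (g := g) hu.continuous hs).deriv_nonpos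
  have hF0 : 0 ≤ deriv (FF n p g u) r := (FF_mono hn p hp hg hgpos hu hs).deriv_nonneg
  rcases hd0.eq_or_lt with hz | hneg
  · rw [hz, abs_zero, Real.zero_rpow (by linarith), zero_mul, mul_zero]; exact hF0
  have hG : 0 < prof n hn g r := prof_pos hn hgpos r hr
  set G := prof n hn g r with hGdef
  set D := -d with hD
  have hD0 : 0 < D := by linarith
  set l := D / G with hl
  have hl0 : 0 < l := by positivity
  have hder : HasDerivAt (fun s => FF n p g u s + p * l ^ (p - 1) * (n * r ^ (n - 1) * ω) * rho n g u s
      + (p - 1) * l ^ p * (G * ω) * s ^ n) (deriv (FF n p g u) r + 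
      p * l ^ (p - 1) * (n * r ^ (n - 1) * ω) * d + (p - 1) * l ^ p * (G * ω) * (n * r ^ (n - 1))) r :=
    (h2.hasDerivAt.add (h1.hasDerivAt.const_mul _)).add ((hasDerivAt_pow n r).const_mul _)
  have hnn := deriv_nonneg_of_right _ _ _ hder (by
    intro s hs'
    have := FF_step hn p hp hg hgpos hu hs r s l hr hs'.le hl0
    rw [← hω, ← hGdef] at this
    linarith)
  have habs : |d| = D := abs_of_neg hneg
  rw [habs]
  have e1 : l ^ (p - 1) * D = D ^ p * G ^ (1 - p) := by
    rw [hl, Real.div_rpow hD0.le hG.le, Real.rpow_sub hD0, Real.rpow_sub hG, Real.rpow_sub hG,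
      Real.rpow_one, Real.rpow_one]
    have := Real.rpow_pos_of_pos hG p
    field_simp
  have e2 : l ^ p * G = D ^ p * G ^ (1 - p) := by
    rw [hl, Real.div_rpow hD0.le hG.le, Real.rpow_sub hG, Real.rpow_one]
    have := Real.rpow_pos_of_pos hG p
    field_simp
  have e3 : p * l ^ (p - 1) * (n * r ^ (n - 1) * ω) * d = 
      - (p * (n * r ^ (n - 1) * ω) * (D ^ p * G ^ (1 - p))) := by
    rw [← e1, hD]; ring
  have e4 : (p - 1) * l ^ p * (G * ω) * (n * r ^ (n - 1)) = 
      (p - 1) * (n * r ^ (n - 1) * ω) * (D ^ p * G ^ (1 - p)) := by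
    rw [← e2]; ring
  rw [e3, e4] at hnn
  linarith

theorem FF_int (hn : 0 < n) (p : ℝ) (hp : 1 ≤ p) (hg : Admissible n g)
    (hgpos : ∀ x : EuclideanSpace ℝ (Fin n), x ≠ 0 → 0 < g x) {K : NNReal}
    (hu : LipschitzWith K u) (hs : HasCompactSupport u) :
    IntegrableOn (deriv (FF n p g u)) (Ioi 0) volume ∧ 
      ∫ r in Ioi 0, deriv (FF n p g u) r ≤ ∫ x, enG n p g u x := by
  have hm := FF_mono hn p hp hg hgpos hu hs
  have hb := FF_bd hn p hp hg hgpos hu hs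
  have hii : ∀ b : ℝ, IntervalIntegrable (deriv (FF n p g u)) volume 0 b := fun b =>
    (hm.monotoneOn _).intervalIntegrable_deriv
  have hle : ∀ b : ℝ, 0 ≤ b → ∫ r in (0:ℝ)..b, deriv (FF n p g u) r ≤ ∫ x, enG n p g u x := by
    intro b hb0
    have := (hm.monotoneOn (uIcc 0 b)).intervalIntegral_deriv_mem_uIcc
    rw [uIcc_of_le (sub_nonneg.2 (hm hb0))] at this
    linarith [this.2, (hb b).2, (hb 0).1]
  have hIntg : IntegrableOn (deriv (FF n p g u)) (Ioi 0) volume := by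
    refine integrableOn_Ioi_of_intervalIntegral_norm_bounded (l := atTop) (b := fun b : ℝ => b)
      (∫ x, enG n p g u x) 0 (fun b => (hii b).1) tendsto_id ?_
    filter_upwards [eventually_ge_atTop 0] with b hb0
    simp only [fun r => norm_of_nonneg (hm.deriv_nonneg (x := r))]
    exact hle b hb0
  refine ⟨hIntg, ?_⟩
  refine le_of_tendsto (intervalIntegral_tendsto_integral_Ioi 0 hIntg tendsto_id) ?_
  filter_upwards [eventually_ge_atTop 0] with b hb0 using hle b hb0

theorem fderiv_rearr_le (hn : 0 < n) (x : EuclideanSpace ℝ (Fin n)) (hx : x ≠ 0) :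
    ‖fderiv ℝ (rearrG n g u) x‖ ≤ |deriv (rho n g u) ‖x‖| := by
  by_cases hd : DifferentiableAt ℝ (rearrG n g u) x
  · have hx0 : 0 < ‖x‖ := norm_pos_iff.2 hx
    have hρ : DifferentiableAt ℝ (rho n g u) ‖x‖ := by
      have h1 : rho n g u =ᶠ[𝓝 ‖x‖] fun s => rearrG n g u ((s / ‖x‖) • x) := by
        filter_upwards [lt_mem_nhds hx0] with s hs
        rw [rearrG_eq, norm_smul, norm_of_nonneg (by positivity), div_mul_cancel₀ _ hx0.ne']
      refine DifferentiableAt.congr_of_eventuallyEq ?_ h1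
      have h2 : DifferentiableAt ℝ (rearrG n g u) ((‖x‖ / ‖x‖) • x) := by
        rwa [div_self hx0.ne', one_smul]
      exact h2.comp ‖x‖ (f := fun s : ℝ => (s / ‖x‖) • x) (by fun_prop)
    have he : rearrG n g u = rho n g u ∘ norm := by
      funext y; exact rearrG_eq n g u y
    have hnd : DifferentiableAt ℝ (norm : EuclideanSpace ℝ (Fin n) → ℝ) x :=
      (contDiffAt_norm ℝ hx (n := 1)).differentiableAt (by simp)
    have h3 := hρ.hasDerivAt.comp_hasFDerivAt x hnd.hasFDerivAt
    rw [he, h3.fderiv, norm_smul, Real.norm_eq_abs]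
    have h4 : ‖fderiv ℝ (norm : EuclideanSpace ℝ (Fin n) → ℝ) x‖ ≤ 1 := by
      simpa using norm_fderiv_le_of_lipschitz ℝ (lipschitzWith_one_norm (E := EuclideanSpace ℝ (Fin n))) (x₀ := x)
    exact mul_le_of_le_one_right (abs_nonneg _) h4
  · rw [fderiv_zero_of_not_differentiableAt hd, norm_zero]; positivity

theorem numer_le (hn : 0 < n) (p : ℝ) (hp : 1 ≤ p) (hg : Admissible n g)
    (hgpos : ∀ x : EuclideanSpace ℝ (Fin n), x ≠ 0 → 0 < g x) {K : NNReal}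
    (hu : LipschitzWith K u) (hs : HasCompactSupport u) :
    ∫ x, enG n p g (rearrG n g u) x ≤ ∫ x, enG n p g u x := by
  have : Nonempty (Fin n) := ⟨⟨0, hn⟩⟩
  set ω := volume.real (Metric.ball (0 : EuclideanSpace ℝ (Fin n)) 1) with hω
  have hω0 : 0 < ω :=
    ENNReal.toReal_pos (Metric.measure_ball_pos _ _ one_pos).ne' measure_ball_lt_top.ne
  obtain ⟨hFi, hFle⟩ := FF_int hn p hp hg hgpos hu hs
  set H : ℝ → ℝ := fun r => |deriv (rho n g u) r| ^ p * prof n hn g r ^ (1 - p) with hH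
  have hae : ∀ᵐ r ∂(volume.restrict (Ioi (0:ℝ))), 
      0 ≤ r ^ (n - 1) * H r ∧ n * ω * (r ^ (n - 1) * H r) ≤ deriv (FF n p g u) r := by
    rw [ae_restrict_iff' measurableSet_Ioi]
    filter_upwards [(FF_mono hn p hp hg hgpos hu hs).ae_differentiableAt, 
      (rho_antitone (g := g) hu.continuous hs).neg.ae_differentiableAt] with r h1 h2 hr
    have hr0 : 0 < r := hr
    refine ⟨?_, ?_⟩
    · have := prof_pos hn hgpos r hr0
      simp only [hH]
      positivity
    · have h2' : DifferentiableAt ℝ (rho n g u) r := by simpa using h2.neg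
      have := FF_deriv hn p hp hg hgpos hu hs r hr0 h2' h1
      simp only [hH]
      rw [← hω] at this
      linarith
  have hHm : AEStronglyMeasurable (fun r => r ^ (n - 1) * H r) (volume.restrict (Ioi (0:ℝ))) := by
    have m1 : AEMeasurable (prof n hn g) (volume.restrict (Ioi (0:ℝ))) :=
      aemeasurable_restrict_of_antitoneOn measurableSet_Ioi (prof_anti hn hg)
    have m2 : Measurable (deriv (rho n g u)) := measurable_deriv _
    apply AEMeasurable.aestronglyMeasurable
    refine AEMeasurable.mul (by fun_prop) (AEMeasurable.mul ?_ (m1.pow_const _))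
    exact (m2.abs.pow_const p).aemeasurable
  have hnω : 0 < n * ω := by positivity
  have hHi : IntegrableOn (fun r => r ^ (n - 1) * H r) (Ioi 0) volume := by
    refine Integrable.mono' (hFi.const_mul (n * ω)⁻¹) hHm ?_
    filter_upwards [hae] with r hr
    rw [norm_of_nonneg hr.1, ← div_eq_inv_mul, le_div_iff₀ hnω]
    linarith [hr.2]
  have hfr : Module.finrank ℝ (EuclideanSpace ℝ (Fin n)) = n := by simp
  have hi : Integrable (fun x : EuclideanSpace ℝ (Fin n) => H ‖x‖) volume := by
    rw [integrable_fun_norm_addHaar, hfr]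
    simpa [smul_eq_mul] using hHi
  calc ∫ x, enG n p g (rearrG n g u) x ≤ ∫ x : EuclideanSpace ℝ (Fin n), H ‖x‖ := by
        apply integral_mono_of_nonneg (enG_nonneg hn p hgpos) hi
        filter_upwards [ae_ne_zero hn] with x hx
        unfold enG
        simp only [hH]
        rw [← prof_eq hn hg x]
        have h2 : 0 ≤ g x ^ (1 - p) := Real.rpow_nonneg (hgpos x hx).le _
        have := fderiv_rearr_le (g := g) (u := u) hn x hx
        gcongr
    _ = n * ω * ∫ r in Ioi 0, r ^ (n - 1) * H r := by
        rw [integral_fun_norm_addHaar, hfr]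
        simp only [smul_eq_mul, nsmul_eq_mul]
        ring
    _ = ∫ r in Ioi 0, n * ω * (r ^ (n - 1) * H r) := by rw [integral_const_mul]
    _ ≤ ∫ r in Ioi 0, deriv (FF n p g u) r := by
        apply integral_mono_ae (hHi.const_mul _) hFi
        filter_upwards [hae] with r hr using hr.2
    _ ≤ _ := hFle

end


section
variable {n : ℕ} {g u v : EuclideanSpace ℝ (Fin n) → ℝ}

theorem nuG_ball_cont (hn : 0 < n) (hg : Admissible n g) (r0 : ℝ) (m : ENNReal)
    (h : ∀ r, r0 < r → m ≤ nuG n g (Metric.ball 0 r)) : m ≤ nuG n g (Metric.ball 0 r0) := by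
  have : Nonempty (Fin n) := ⟨⟨0, hn⟩⟩
  have : Nontrivial (EuclideanSpace ℝ (Fin n)) :=
    ⟨⟨unitV n hn, 0, by simpa using smul_unitV_ne hn 1 one_pos⟩⟩
  have hseq : Metric.closedBall (0 : EuclideanSpace ℝ (Fin n)) r0 =
      ⋂ k : ℕ, Metric.ball 0 (r0 + 1 / ((k:ℝ) + 1)) := by
    ext x
    simp only [Metric.mem_closedBall, mem_iInter, Metric.mem_ball]
    constructor
    · intro hx k
      have : (0:ℝ) < 1 / ((k:ℝ) + 1) := by positivity
      linarith
    · intro hx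
      by_contra hc
      obtain ⟨k, hk⟩ := exists_nat_one_div_lt (sub_pos.2 (not_le.1 hc))
      have := hx k
      linarith
  have h1 : m ≤ nuG n g (Metric.closedBall 0 r0) := by
    rw [hseq, Antitone.measure_iInter]
    · refine le_iInf fun k => h _ ?_
      have : (0:ℝ) < 1 / ((k:ℝ) + 1) := by positivity
      linarith
    · intro i j hij
      apply Metric.ball_subset_ball
      have : (1:ℝ) / ((j:ℝ) + 1) ≤ 1 / ((i:ℝ) + 1) := by
        apply one_div_le_one_div_of_le (by positivity)
        have : (i:ℝ) ≤ j := by exact_mod_cast hij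
        linarith
      linarith
    · exact fun k => Metric.isOpen_ball.nullMeasurableSet
    · exact ⟨0, (nuG_ball hg.1 _).ne⟩
  have h2 : nuG n g (Metric.sphere 0 r0) = 0 :=
    withDensity_absolutelyContinuous _ _ (Measure.addHaar_sphere _ _ _)
  refine h1.trans ?_
  rw [← Metric.ball_union_sphere]
  refine (measure_union_le _ _).trans ?_
  rw [h2, add_zero]

theorem level_le (hn : 0 < n) (hg : Admissible n g) (m : ENNReal)
    (hm : m ≤ nuG n g univ) :
    m ≤ nuG n g {x | nuG n g (Metric.ball 0 ‖x‖) < m} := by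
  by_cases hA : {r : ℝ | 0 ≤ r ∧ m ≤ nuG n g (Metric.ball 0 r)}.Nonempty
  · set A := {r : ℝ | 0 ≤ r ∧ m ≤ nuG n g (Metric.ball 0 r)} with hAd
    have hb : BddBelow A := ⟨0, fun r hr => hr.1⟩
    have h1 : m ≤ nuG n g (Metric.ball 0 (sInf A)) := by
      apply nuG_ball_cont hn hg
      intro r hr
      obtain ⟨a, ha, har⟩ := (csInf_lt_iff hb hA).1 hr
      exact ha.2.trans (measure_mono (Metric.ball_subset_ball har.le))
    refine h1.trans (measure_mono fun x hx => ?_)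
    rw [mem_ball_zero_iff] at hx
    show nuG n g (Metric.ball 0 ‖x‖) < m
    by_contra hc
    exact absurd (csInf_le hb (⟨norm_nonneg _, not_lt.1 hc⟩ : ‖x‖ ∈ A)) (not_le.2 hx)
  · refine hm.trans (measure_mono fun x _ => ?_)
    show nuG n g (Metric.ball 0 ‖x‖) < m
    by_contra hc
    exact hA ⟨‖x‖, norm_nonneg _, not_lt.1 hc⟩

theorem v_meas (hn : 0 < n) 
    (hvrad : ∀ x y : EuclideanSpace ℝ (Fin n), ‖x‖ = ‖y‖ → v x = v y)
    (hvmono : ∀ x y : EuclideanSpace ℝ (Fin n), ‖x‖ ≤ ‖y‖ → v y ≤ v x) : Measurable v := by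
  have h1 : v = (fun r : ℝ => v (max r 0 • unitV n hn)) ∘ norm := by
    funext x
    apply hvrad
    rw [norm_smul_unitV hn _ (le_max_right _ _), max_eq_left (norm_nonneg _)]
  have h2 : Antitone (fun r : ℝ => v (max r 0 • unitV n hn)) := by
    intro a b hab
    apply hvmono
    rw [norm_smul_unitV hn _ (le_max_right _ _), norm_smul_unitV hn _ (le_max_right _ _)]
    exact max_le_max hab le_rfl
  rw [h1]
  exact h2.measurable.comp measurable_norm

theorem rearr_meas (hu : Continuous u) (hs : HasCompactSupport u) : Measurable (rearrG n g u) := by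
  have : rearrG n g u = rho n g u ∘ norm := funext fun x => rearrG_eq n g u x
  rw [this]
  exact (rho_antitone hu hs).measurable.comp measurable_norm

theorem lint_eq (hn : 0 < n) (hg : Admissible n g)
    (hgpos : ∀ x : EuclideanSpace ℝ (Fin n), x ≠ 0 → 0 < g x)
    (hv0 : ∀ x, 0 ≤ v x) (hv : Measurable v) (q : ℝ) (f : EuclideanSpace ℝ (Fin n) → ℝ)
    (hf : Measurable f) (hf0 : ∀ x, 0 ≤ f x) :
    ∫⁻ x, ENNReal.ofReal (f x ^ q) ∂((nuG n g).withDensity fun x => ENNReal.ofReal (v x)) =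
      ∫⁻ x, ENNReal.ofReal (f x ^ q * v x * g x) := by
  have hfq : Measurable fun x => ENNReal.ofReal (f x ^ q) := (hf.pow_const q).ennreal_ofReal
  rw [lintegral_withDensity_eq_lintegral_mul _ hv.ennreal_ofReal hfq, nuG,
    lintegral_withDensity_eq_lintegral_mul₀ (g_meas hg).ennreal_ofReal
      (hv.ennreal_ofReal.mul hfq).aemeasurable]
  refine lintegral_congr_ae ?_
  filter_upwards [ae_ne_zero hn] with x hx
  simp only [Pi.mul_apply]
  rw [ENNReal.ofReal_mul (mul_nonneg (Real.rpow_nonneg (hf0 x) q) (hv0 x)),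
    ENNReal.ofReal_mul (Real.rpow_nonneg (hf0 x) q)]
  ring

theorem hardy_lint (hn : 0 < n) (hg : Admissible n g)
    (hgpos : ∀ x : EuclideanSpace ℝ (Fin n), x ≠ 0 → 0 < g x)
    (hv0 : ∀ x, 0 ≤ v x)
    (hvrad : ∀ x y : EuclideanSpace ℝ (Fin n), ‖x‖ = ‖y‖ → v x = v y)
    (hvmono : ∀ x y : EuclideanSpace ℝ (Fin n), ‖x‖ ≤ ‖y‖ → v y ≤ v x)
    (q : ℝ) (hq : 1 ≤ q) (hu : Continuous u) (hs : HasCompactSupport u) :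
    ∫⁻ x, ENNReal.ofReal (|u x| ^ q * v x * g x) ≤
      ∫⁻ x, ENNReal.ofReal (rearrG n g u x ^ q * v x * g x) := by
  have hv := v_meas hn hvrad hvmono
  have hR := rearr_meas (g := g) hu hs
  have hR0 : ∀ x, 0 ≤ rearrG n g u x := fun x => by rw [rearrG_eq]; exact rho_nonneg _
  have huM : Measurable fun x => |u x| := hu.abs.measurable
  rw [← lint_eq hn hg hgpos hv0 hv q (fun x => |u x|) huM (fun x => abs_nonneg _),
    ← lint_eq hn hg hgpos hv0 hv q _ hR hR0,
    lintegral_rpow_eq_lintegral_meas_lt_mul _ (Eventually.of_forall fun x => abs_nonneg (u x))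
      huM.aemeasurable (by linarith),
    lintegral_rpow_eq_lintegral_meas_lt_mul _ (Eventually.of_forall hR0) hR.aemeasurable
      (by linarith)]
  refine mul_le_mul' le_rfl (setLIntegral_mono' measurableSet_Ioi fun t ht => ?_)
  have ht0 : (0:ℝ) ≤ t := le_of_lt ht
  refine mul_le_mul' ?_ le_rfl
  have hS : MeasurableSet {x | t < |u x|} := measurableSet_lt measurable_const huM
  have hT : MeasurableSet {x | t < rearrG n g u x} := measurableSet_lt measurable_const hR
  rw [withDensity_apply _ hS, withDensity_apply _ hT]
  have hTeq : {x | t < rearrG n g u x} =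
      {x | nuG n g (Metric.ball 0 ‖x‖) < nuG n g {x | t < |u x|}} := by
    ext x
    simp only [mem_ofPred_eq]
    rw [rearrG_eq, lt_rho_iff hu hs _ _ ht0]
  apply bathtub (nuG n g) _ (⨆ x : ({x | t < rearrG n g u x}ᶜ : Set (EuclideanSpace ℝ (Fin n))), ENNReal.ofReal (v x)) _ _ hS hT
  · rw [hTeq]
    exact level_le hn hg _ (measure_mono (subset_univ _))
  · exact (nuG_level hg.1 hs t ht0).ne
  · refine Eventually.of_forall fun x hx => ?_
    exact le_iSup (fun x : ({x | t < rearrG n g u x}ᶜ : Set (EuclideanSpace ℝ (Fin n))) => ENNReal.ofReal (v x)) ⟨x, hx⟩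
  · refine Eventually.of_forall fun x hx => iSup_le fun y => ENNReal.ofReal_le_ofReal ?_
    apply hvmono
    by_contra hc
    apply y.2
    have hx' : t < rearrG n g u x := hx
    show t < rearrG n g u y
    rw [rearrG_eq] at hx' ⊢
    exact hx'.trans_le (rho_antitone hu hs (not_le.1 hc).le)

theorem hardy_int (hn : 0 < n) (hg : Admissible n g)
    (hgpos : ∀ x : EuclideanSpace ℝ (Fin n), x ≠ 0 → 0 < g x)
    (hv0 : ∀ x, 0 ≤ v x)
    (hvrad : ∀ x y : EuclideanSpace ℝ (Fin n), ‖x‖ = ‖y‖ → v x = v y)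
    (hvmono : ∀ x y : EuclideanSpace ℝ (Fin n), ‖x‖ ≤ ‖y‖ → v y ≤ v x)
    (q : ℝ) (hq : 1 ≤ q) (hu : Continuous u) (hs : HasCompactSupport u)
    (hI : Integrable fun x => rearrG n g u x ^ q * v x * g x) :
    ∫ x, |u x| ^ q * v x * g x ≤ ∫ x, rearrG n g u x ^ q * v x * g x := by
  have hv := v_meas hn hvrad hvmono
  have hR0 : ∀ x, 0 ≤ rearrG n g u x := fun x => by rw [rearrG_eq]; exact rho_nonneg _
  rw [integral_eq_lintegral_of_nonneg_ae _ _, integral_eq_lintegral_of_nonneg_ae _ hI.1]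
  · refine ENNReal.toReal_mono ?_ (hardy_lint hn hg hgpos hv0 hvrad hvmono q hq hu hs)
    exact hI.lintegral_lt_top.ne
  · filter_upwards [ae_ne_zero hn] with x hx
    exact mul_nonneg (mul_nonneg (Real.rpow_nonneg (hR0 x) q) (hv0 x)) (hgpos x hx).le
  · filter_upwards [ae_ne_zero hn] with x hx
    exact mul_nonneg (mul_nonneg (Real.rpow_nonneg (abs_nonneg _) q) (hv0 x)) (hgpos x hx).le
  · exact (((hu.abs.measurable.pow_const q).mul hv).aemeasurable.mul
      (g_meas hg)).aestronglyMeasurable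
end

/-- Quotient form of the rearrangement inequality: for `1 ≤ p, q < ∞`, admissible `g > 0`
off the origin, and `v ≥ 0` radial nonincreasing, every compactly supported Lipschitz `u`
with `∫ |u|^q v g > 0` satisfies
`(∫ |∇u|^p g^{1-p}) / (∫ |u|^q v g)^{p/q} ≥ (∫ |∇R_g[u]|^p g^{1-p}) / (∫ R_g[u]^q v g)^{p/q}`. -/
theorem stmt13 (n : ℕ) (p q : ℝ) (hp : 1 ≤ p) (hq : 1 ≤ q)
    (g : EuclideanSpace ℝ (Fin n) → ℝ)
    (hg : Admissible n g) (hgpos : ∀ x : EuclideanSpace ℝ (Fin n), x ≠ 0 → 0 < g x)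
    (v : EuclideanSpace ℝ (Fin n) → ℝ)
    (hv0 : ∀ x, 0 ≤ v x)
    (hvrad : ∀ x y : EuclideanSpace ℝ (Fin n), ‖x‖ = ‖y‖ → v x = v y)
    (hvmono : ∀ x y : EuclideanSpace ℝ (Fin n), ‖x‖ ≤ ‖y‖ → v y ≤ v x)
    (u : EuclideanSpace ℝ (Fin n) → ℝ) (K : NNReal) (hu : LipschitzWith K u)
    (hsupp : HasCompactSupport u)
    (hpos : 0 < ∫ x, |u x| ^ q * v x * g x) :
    (∫ x, ‖fderiv ℝ (rearrG n g u) x‖ ^ p * g x ^ (1 - p)) /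
        (∫ x, (rearrG n g u x) ^ q * v x * g x) ^ (p / q) ≤
      (∫ x, ‖fderiv ℝ u x‖ ^ p * g x ^ (1 - p)) /
        (∫ x, |u x| ^ q * v x * g x) ^ (p / q) := by
  have hp0 : p ≠ 0 := by linarith
  have hpq : 0 < p / q := div_pos (by linarith) (by linarith)
  rcases Nat.eq_zero_or_pos n with h0 | hn
  · subst h0
    have hz : ∀ w : EuclideanSpace ℝ (Fin 0) → ℝ, ∀ x, ‖fderiv ℝ w x‖ ^ p = 0 := by
      intro w x
      have : fderiv ℝ w x = 0 := by
        ext y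
        rw [Subsingleton.elim y 0]
        simp
      rw [this, norm_zero, Real.zero_rpow hp0]
    simp only [hz, zero_mul, integral_zero, zero_div, le_refl]
  · have hN := numer_le hn p hp hg hgpos hu hsupp
    have hN0 : 0 ≤ ∫ x, enG n p g u x := integral_nonneg_of_ae (enG_nonneg hn p hgpos)
    simp only [enG] at hN hN0
    by_cases hI : Integrable fun x => rearrG n g u x ^ q * v x * g x
    · have hD := hardy_int hn hg hgpos hv0 hvrad hvmono q hq hu.continuous hsupp hI
      exact div_le_div₀ hN0 hN (Real.rpow_pos_of_pos hpos _)
        (Real.rpow_le_rpow hpos.le hD hpq.le)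
    · rw [integral_undef hI, Real.zero_rpow hpq.ne', div_zero]
      exact div_nonneg hN0 (Real.rpow_nonneg hpos.le _)
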